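/- arXiv:0808.0467 — 5 statements merged into one kernel-verified Lean document; each statement's English description precedes it below -/
import Mathlib

section
/- For a complex number s with 0 < Re(s) < 1, the zeroth Fourier coefficient of ζ₁(s,·) on [0,1] equals 1/(s-1); that is, ∫₀¹ (ζ(s,α) - α^{-s}) dα = 1/(s-1). -/
open HurwitzZeta Complex Real

open Set Filter Topology MeasureTheory

lemma norm_ofReal_add_cpow_sub_le {x t : ℝ} (hx : 0 < x) (ht : t ∈ Icc (0 : ℝ) 1) {c : ℂ}
    (hc : c.re ≤ 1) :
    ‖((x + t : ℝ) : ℂ) ^ c - (x : ℂ) ^ c‖ ≤ ‖c‖ * x ^ (c.re - 1) := by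
  rcases eq_or_ne c 0 with rfl | hc0
  · simp
  have hpos : ∀ y ∈ Ici x, 0 < y := fun y hy ↦ hx.trans_le hy
  have key := (convex_Ici x).norm_image_sub_le_of_norm_hasDerivWithin_le
    (f := fun y : ℝ ↦ (y : ℂ) ^ c) (f' := fun y : ℝ ↦ c * (y : ℂ) ^ (c - 1))
    (C := ‖c‖ * x ^ (c.re - 1)) (x := x) (y := x + t)
    (fun y hy ↦ (hasDerivAt_ofReal_cpow_const (hpos y hy).ne' hc0).hasDerivWithinAt)
    (fun y hy ↦ by
      rw [norm_mul, norm_cpow_eq_rpow_re_of_pos (hpos y hy)]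
      simp only [sub_re, one_re]
      exact mul_le_mul_of_nonneg_left
        (rpow_le_rpow_of_nonpos hx hy (sub_nonpos.2 hc)) (norm_nonneg c))
    self_mem_Ici (by simpa using ht.1)
  refine key.trans (mul_le_of_le_one_right (by positivity) ?_)
  rw [add_sub_cancel_left, Real.norm_of_nonneg ht.1]
  exact ht.2

/-- The difference between `x ^ (-s)` and `∫ y in x..x+1, y ^ (-s)`. -/
noncomputable def cpowSubIntegral (s : ℂ) (x : ℝ) : ℂ :=
  (x : ℂ) ^ (-s) - (((x + 1 : ℝ) : ℂ) ^ (1 - s) - (x : ℂ) ^ (1 - s)) / (1 - s)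

lemma integral_cpow_neg_shift {s : ℂ} (hs : s ≠ 1) {x : ℝ} (hx : 0 < x) :
    ∫ t in (0 : ℝ)..1, ((x + t : ℝ) : ℂ) ^ (-s) =
      (((x + 1 : ℝ) : ℂ) ^ (1 - s) - (x : ℂ) ^ (1 - s)) / (1 - s) := by
  rw [intervalIntegral.integral_comp_add_left (fun y : ℝ ↦ (y : ℂ) ^ (-s)) x, integral_cpow]
  · simp [neg_add_eq_sub]
  · refine Or.inr ⟨by simpa [neg_eq_iff_eq_neg] using hs, ?_⟩
    rw [uIcc_of_le (by linarith)]
    exact fun h ↦ (h.1.trans_lt' (by simpa using hx)).false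

lemma continuousOn_shift_cpow (c : ℂ) {x : ℝ} (hx : 0 < x) :
    ContinuousOn (fun t : ℝ ↦ ((x + t : ℝ) : ℂ) ^ c) (Icc 0 1) := by
  refine ContinuousOn.cpow_const (by fun_prop) fun t ht ↦ ?_
  exact ofReal_mem_slitPlane.2 (by linarith [ht.1])

lemma intervalIntegrable_shift_cpow (c : ℂ) {x : ℝ} (hx : 0 < x) :
    IntervalIntegrable (fun t : ℝ ↦ ((x + t : ℝ) : ℂ) ^ c) volume 0 1 :=
  ContinuousOn.intervalIntegrable (by
    rw [uIcc_of_le zero_le_one]; exact continuousOn_shift_cpow c hx)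

lemma norm_cpowSubIntegral_le {s : ℂ} (hs0 : 0 ≤ s.re) (hs : s ≠ 1) {x : ℝ} (hx : 0 < x) :
    ‖cpowSubIntegral s x‖ ≤ ‖s‖ * x ^ (-s.re - 1) := by
  have h : cpowSubIntegral s x =
      -∫ t in (0 : ℝ)..1, (((x + t : ℝ) : ℂ) ^ (-s) - (x : ℂ) ^ (-s)) := by
    rw [intervalIntegral.integral_sub (intervalIntegrable_shift_cpow _ hx) (by simp),
      integral_cpow_neg_shift hs hx]
    simp [cpowSubIntegral]
  rw [h, norm_neg]
  refine (intervalIntegral.norm_integral_le_of_norm_le_const (C := ‖s‖ * x ^ (-s.re - 1))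
    fun t ht ↦ ?_).trans_eq (by simp)
  rw [uIoc_of_le zero_le_one] at ht
  simpa using norm_ofReal_add_cpow_sub_le hx (Ioc_subset_Icc_self ht) (c := -s)
    (by simpa using by linarith)

lemma norm_cpowSubIntegral_nat_le {s : ℂ} {δ R : ℝ} (hδ : 0 ≤ δ) (hs0 : δ ≤ s.re) (hR : ‖s‖ ≤ R)
    (hs : s ≠ 1) {a : ℝ} (ha : 0 ≤ a) (n : ℕ) :
    ‖cpowSubIntegral s (n + 1 + a)‖ ≤ R * ((n + 1 : ℕ) : ℝ) ^ (-δ - 1) := by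
  have hn : (1 : ℝ) ≤ n + 1 := by simp
  refine (norm_cpowSubIntegral_le (hδ.trans hs0) hs (by linarith)).trans ?_
  push_cast
  refine mul_le_mul hR ?_ (by positivity) ((norm_nonneg s).trans hR)
  calc ((n : ℝ) + 1 + a) ^ (-s.re - 1) ≤ ((n : ℝ) + 1) ^ (-s.re - 1) :=
        rpow_le_rpow_of_nonpos (by linarith) (by linarith) (by linarith)
    _ ≤ _ := rpow_le_rpow_of_exponent_le hn (by linarith)

lemma summable_const_mul_succ_rpow {δ : ℝ} (hδ : 0 < δ) (R : ℝ) :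
    Summable fun n : ℕ ↦ R * ((n + 1 : ℕ) : ℝ) ^ (-δ - 1) :=
  ((summable_nat_add_iff 1).2 (summable_nat_rpow.2 (by linarith : -δ - 1 < -1))).mul_left R

lemma summable_cpowSubIntegral {s : ℂ} (hs0 : 0 < s.re) (hs : s ≠ 1) {a : ℝ} (ha : 0 ≤ a) :
    Summable fun n : ℕ ↦ cpowSubIntegral s (n + 1 + a) :=
  .of_norm_bounded (summable_const_mul_succ_rpow hs0 ‖s‖)
    fun n ↦ norm_cpowSubIntegral_nat_le hs0.le le_rfl le_rfl hs ha n

lemma differentiableAt_cpowSubIntegral {s : ℂ} (hs : s ≠ 1) {x : ℝ} (hx : 0 < x) :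
    DifferentiableAt ℂ (fun z ↦ cpowSubIntegral z x) s := by
  have h1 : (x : ℂ) ≠ 0 := by exact_mod_cast hx.ne'
  have h2 : ((x + 1 : ℝ) : ℂ) ≠ 0 := by exact_mod_cast (by linarith : 0 < x + 1).ne'
  have h3 : (1 : ℂ) - s ≠ 0 := sub_ne_zero.2 hs.symm
  unfold cpowSubIntegral
  refine .sub (.const_cpow (by fun_prop) (.inl h1)) (.div (.sub ?_ ?_) (by fun_prop) h3)
  · exact .const_cpow (by fun_prop) (.inl h2)
  · exact .const_cpow (by fun_prop) (.inl h1)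

lemma differentiableAt_tsum_cpowSubIntegral {s : ℂ} (hs0 : 0 < s.re) (hs : s ≠ 1) {a : ℝ}
    (ha : 0 ≤ a) :
    DifferentiableAt ℂ (fun z ↦ ∑' n : ℕ, cpowSubIntegral z (n + 1 + a)) s := by
  set U : Set ℂ := {z | s.re / 2 < z.re} ∩ {z | ‖z‖ < ‖s‖ + 1} ∩ {1}ᶜ
  have hU : IsOpen U := ((isOpen_lt continuous_const continuous_re).inter
    (isOpen_lt continuous_norm continuous_const)).inter isOpen_compl_singleton
  have hsU : s ∈ U := ⟨⟨by simpa using hs0, by simp⟩, hs⟩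
  refine (differentiableOn_tsum_of_summable_norm
    (summable_const_mul_succ_rpow (half_pos hs0) (‖s‖ + 1)) (fun n z hz ↦ ?_) hU
    fun n z hz ↦ ?_).differentiableAt (hU.mem_nhds hsU)
  · exact (differentiableAt_cpowSubIntegral hz.2 (by positivity)).differentiableWithinAt
  · exact norm_cpowSubIntegral_nat_le (half_pos hs0).le hz.1.1.le hz.1.2.le hz.2 ha n

lemma hurwitzZeta_eq_of_one_lt_re {s : ℂ} (hs : 1 < s.re) {a : ℝ} (ha : a ∈ Icc (0 : ℝ) 1) :
    hurwitzZeta a s = (a : ℂ) ^ (-s) + ∑' n : ℕ, cpowSubIntegral s (n + 1 + a)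
      - ((1 + a : ℝ) : ℂ) ^ (1 - s) / (1 - s) := by
  have hs1 : s ≠ 1 := by rintro rfl; simp at hs
  have hz := (hasSum_nat_add_iff' 1).2 (hasSum_hurwitzZeta_of_one_lt_re ha hs)
  have hw := (summable_cpowSubIntegral (by linarith) hs1 ha.1).hasSum
  have hd := (hz.sub hw).tendsto_sum_nat
  have hsum : ∀ N : ℕ, ∑ n ∈ Finset.range N,
      (1 / (((n + 1 : ℕ) : ℂ) + a) ^ s - cpowSubIntegral s (n + 1 + a)) =
      ((N + 1 + a : ℝ) : ℂ) ^ (1 - s) / (1 - s) - ((1 + a : ℝ) : ℂ) ^ (1 - s) / (1 - s) := by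
    intro N
    have := Finset.sum_range_sub (fun n : ℕ ↦ ((n + 1 + a : ℝ) : ℂ) ^ (1 - s) / (1 - s)) N
    simp only [Nat.cast_zero, zero_add] at this
    rw [← this]
    refine Finset.sum_congr rfl fun n _ ↦ ?_
    rw [cpowSubIntegral, one_div, ← cpow_neg]
    push_cast
    rw [show (n : ℂ) + 1 + 1 + a = n + 1 + a + 1 by ring]
    ring
  have hlim : Tendsto (fun N : ℕ ↦ ((N + 1 + a : ℝ) : ℂ) ^ (1 - s)) atTop (𝓝 0) := by
    rw [tendsto_zero_iff_norm_tendsto_zero]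
    have hN : Tendsto (fun N : ℕ ↦ (N : ℝ) + 1 + a) atTop atTop :=
      tendsto_atTop_add_const_right _ _ (tendsto_atTop_add_const_right _ _
        tendsto_natCast_atTop_atTop)
    refine ((tendsto_rpow_neg_atTop (sub_pos.2 hs)).comp hN).congr fun N ↦ ?_
    have : (0 : ℝ) < N + 1 + a := by linarith [ha.1, (Nat.cast_nonneg N : (0 : ℝ) ≤ N)]
    rw [norm_cpow_eq_rpow_re_of_pos this]
    simp
  simp only [hsum] at hd
  have := tendsto_nhds_unique hd ((hlim.div_const (1 - s)).sub_const _)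
  simp only [Finset.range_one, Finset.sum_singleton, Nat.cast_zero, zero_add, one_div,
    ← cpow_neg, zero_div, zero_sub] at this
  linear_combination this

lemma hurwitzZeta_eq_of_re_pos_of_re_lt_one {s : ℂ} (hs0 : 0 < s.re) (hs1 : s.re < 1) {a : ℝ}
    (ha : a ∈ Ioc (0 : ℝ) 1) :
    hurwitzZeta a s = (a : ℂ) ^ (-s) + ∑' n : ℕ, cpowSubIntegral s (n + 1 + a)
      - ((1 + a : ℝ) : ℂ) ^ (1 - s) / (1 - s) := by
  set f : ℂ → ℂ := fun s ↦ (a : ℂ) ^ (-s) + ∑' n : ℕ, cpowSubIntegral s (n + 1 + a)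
      - ((1 + a : ℝ) : ℂ) ^ (1 - s) / (1 - s)
  set A : Set ℂ := {z | 1 < z.re}
  set B : Set ℂ := {z | 0 < z.re} ∩ {z | 0 < z.im}
  set C : Set ℂ := {z | 0 < z.re} ∩ {z | z.re < 1}
  have hA : IsPreconnected A := (convex_halfSpace_re_gt 1).isPreconnected
  have hB : IsPreconnected B :=
    ((convex_halfSpace_re_gt 0).inter (convex_halfSpace_im_gt 0)).isPreconnected
  have hC : IsPreconnected C :=
    ((convex_halfSpace_re_gt 0).inter (convex_halfSpace_re_lt 1)).isPreconnected
  have hU : IsPreconnected ((A ∪ B) ∪ C) := by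
    refine (hA.union (2 + I) ?_ ?_ hB).union (1 / 2 + I) (.inr ?_) ?_ hC <;>
      norm_num [A, B, C]
  have hUo : IsOpen ((A ∪ B) ∪ C) := by
    have h (c : ℝ) : IsOpen {z : ℂ | c < z.re} := isOpen_lt continuous_const continuous_re
    exact ((h 1).union ((h 0).inter (isOpen_lt continuous_const continuous_im))).union
      ((h 0).inter (isOpen_lt continuous_re continuous_const))
  have hmem : ∀ z ∈ (A ∪ B) ∪ C, 0 < z.re ∧ z ≠ 1 := by
    rintro z ((hz | hz) | hz)
    · exact ⟨zero_lt_one.trans hz, by rintro rfl; simp [A] at hz⟩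
    · exact ⟨hz.1, by rintro rfl; simp [B] at hz⟩
    · exact ⟨hz.1, by rintro rfl; simp [C] at hz⟩
  have ha0 : (a : ℂ) ≠ 0 := by exact_mod_cast ha.1.ne'
  have ha1 : ((1 + a : ℝ) : ℂ) ≠ 0 := by exact_mod_cast (by linarith [ha.1] : 0 < 1 + a).ne'
  have hf : DifferentiableOn ℂ f ((A ∪ B) ∪ C) := fun z hz ↦ by
    obtain ⟨hz0, hz1⟩ := hmem z hz
    refine DifferentiableAt.differentiableWithinAt (.sub (.add ?_ ?_) (.div ?_ (by fun_prop) ?_))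
    · exact .const_cpow (by fun_prop) (.inl ha0)
    · exact differentiableAt_tsum_cpowSubIntegral hz0 hz1 ha.1.le
    · exact .const_cpow (by fun_prop) (.inl ha1)
    · exact sub_ne_zero.2 hz1.symm
  have hg : DifferentiableOn ℂ (hurwitzZeta a) ((A ∪ B) ∪ C) := fun z hz ↦
    (differentiableAt_hurwitzZeta a (hmem z hz).2).differentiableWithinAt
  have h2 : (2 : ℂ) ∈ A := by simp [A]
  refine (hg.analyticOnNhd hUo).eqOn_of_preconnected_of_eventuallyEq (hf.analyticOnNhd hUo) hU
    (.inl (.inl h2)) ?_ (.inr ⟨hs0, hs1⟩)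
  filter_upwards [(isOpen_lt continuous_const continuous_re).mem_nhds h2] with z hz
  exact hurwitzZeta_eq_of_one_lt_re hz (Ioc_subset_Icc_self ha)

/-- An antiderivative of `y ↦ y ^ (-s)` at `x`, minus its mean over `[x, x + 1]`. -/
noncomputable def cpowSubMean (s : ℂ) (x : ℝ) : ℂ :=
  ((x : ℂ) ^ (1 - s) - ∫ t in (0 : ℝ)..1, ((x + t : ℝ) : ℂ) ^ (1 - s)) / (1 - s)

lemma norm_cpowSubMean_le {s : ℂ} (hs0 : 0 ≤ s.re) (hs : s ≠ 1) {x : ℝ} (hx : 0 < x) :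
    ‖cpowSubMean s x‖ ≤ x ^ (-s.re) := by
  have h3 : (1 : ℂ) - s ≠ 0 := sub_ne_zero.2 hs.symm
  have h : cpowSubMean s x =
      -(∫ t in (0 : ℝ)..1, (((x + t : ℝ) : ℂ) ^ (1 - s) - (x : ℂ) ^ (1 - s))) / (1 - s) := by
    rw [intervalIntegral.integral_sub (intervalIntegrable_shift_cpow _ hx) (by simp)]
    simp [cpowSubMean]
  rw [h, norm_div, norm_neg, div_le_iff₀ (norm_pos_iff.2 h3), mul_comm]
  refine (intervalIntegral.norm_integral_le_of_norm_le_const (C := ‖1 - s‖ * x ^ (-s.re))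
    fun t ht ↦ ?_).trans_eq (by simp)
  rw [uIoc_of_le zero_le_one] at ht
  simpa using norm_ofReal_add_cpow_sub_le hx (Ioc_subset_Icc_self ht) (c := 1 - s)
    (by simpa using hs0)

lemma continuousOn_cpowSubIntegral_shift (s : ℂ) {x : ℝ} (hx : 0 < x) :
    ContinuousOn (fun t ↦ cpowSubIntegral s (x + t)) (Icc 0 1) := by
  have h : ∀ t : ℝ, x + t + 1 = x + 1 + t := fun t ↦ by ring
  simp only [cpowSubIntegral, h]
  exact (continuousOn_shift_cpow _ hx).sub (((continuousOn_shift_cpow _ (by linarith)).sub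
    (continuousOn_shift_cpow _ hx)).div_const _)

lemma integral_cpowSubIntegral {s : ℂ} (hs : s ≠ 1) {x : ℝ} (hx : 0 < x) :
    ∫ t in (0 : ℝ)..1, cpowSubIntegral s (x + t) = cpowSubMean s (x + 1) - cpowSubMean s x := by
  have h : ∀ t : ℝ, x + t + 1 = x + 1 + t := fun t ↦ by ring
  have hx1 : 0 < x + 1 := by linarith
  simp only [cpowSubIntegral, h]
  rw [intervalIntegral.integral_sub (intervalIntegrable_shift_cpow _ hx)
    (((intervalIntegrable_shift_cpow _ hx1).sub (intervalIntegrable_shift_cpow _ hx)).div_const _),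
    intervalIntegral.integral_div, intervalIntegral.integral_sub
      (intervalIntegrable_shift_cpow _ hx1) (intervalIntegrable_shift_cpow _ hx),
    integral_cpow_neg_shift hs hx, cpowSubMean, cpowSubMean]
  ring

lemma hasSum_integral_cpowSubIntegral {s : ℂ} (hs0 : 0 < s.re) (hs : s ≠ 1) :
    HasSum (fun n : ℕ ↦ ∫ t in (0 : ℝ)..1, cpowSubIntegral s (n + 1 + t))
      (∫ t in (0 : ℝ)..1, ∑' n : ℕ, cpowSubIntegral s (n + 1 + t)) := by
  refine intervalIntegral.hasSum_integral_of_dominated_convergence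
    (fun n _ ↦ ‖s‖ * ((n + 1 : ℕ) : ℝ) ^ (-s.re - 1)) (fun n ↦ ?_) (fun n ↦ ?_) ?_ (by simp) ?_
  · rw [uIoc_of_le zero_le_one]
    exact ((continuousOn_cpowSubIntegral_shift s (by positivity)).mono
      Ioc_subset_Icc_self).aestronglyMeasurable measurableSet_Ioc
  · refine .of_forall fun t ht ↦ ?_
    rw [uIoc_of_le zero_le_one] at ht
    exact norm_cpowSubIntegral_nat_le hs0.le le_rfl le_rfl hs ht.1.le n
  · exact .of_forall fun t _ ↦ summable_const_mul_succ_rpow hs0 ‖s‖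
  · refine .of_forall fun t ht ↦ ?_
    rw [uIoc_of_le zero_le_one] at ht
    exact (summable_cpowSubIntegral hs0 hs ht.1.le).hasSum

lemma integral_tsum_cpowSubIntegral {s : ℂ} (hs0 : 0 < s.re) (hs : s ≠ 1) :
    ∫ t in (0 : ℝ)..1, ∑' n : ℕ, cpowSubIntegral s (n + 1 + t) = -cpowSubMean s 1 := by
  have hd := (hasSum_integral_cpowSubIntegral hs0 hs).tendsto_sum_nat
  have hsum : ∀ N : ℕ, ∑ n ∈ Finset.range N, ∫ t in (0 : ℝ)..1, cpowSubIntegral s (n + 1 + t) =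
      cpowSubMean s (N + 1) - cpowSubMean s 1 := by
    intro N
    have := Finset.sum_range_sub (fun n : ℕ ↦ cpowSubMean s (n + 1)) N
    simp only [Nat.cast_zero, zero_add] at this
    rw [← this]
    refine Finset.sum_congr rfl fun n _ ↦ ?_
    rw [integral_cpowSubIntegral hs (by positivity)]
    push_cast
    rfl
  have hlim : Tendsto (fun N : ℕ ↦ cpowSubMean s (N + 1)) atTop (𝓝 0) :=
    squeeze_zero_norm (fun N ↦ norm_cpowSubMean_le hs0.le hs (by positivity))
      ((tendsto_rpow_neg_atTop hs0).comp
        (tendsto_atTop_add_const_right _ _ tendsto_natCast_atTop_atTop))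
  simp only [hsum] at hd
  simpa using tendsto_nhds_unique hd (hlim.sub_const _)

lemma intervalIntegrable_tsum_cpowSubIntegral {s : ℂ} (hs0 : 0 < s.re) (hs : s ≠ 1) :
    IntervalIntegrable (fun t : ℝ ↦ ∑' n : ℕ, cpowSubIntegral s (n + 1 + t)) volume 0 1 := by
  refine ContinuousOn.intervalIntegrable ?_
  rw [uIcc_of_le zero_le_one]
  exact continuousOn_tsum (fun n ↦ continuousOn_cpowSubIntegral_shift s (by positivity))
    (summable_const_mul_succ_rpow hs0 ‖s‖)
    fun n t ht ↦ norm_cpowSubIntegral_nat_le hs0.le le_rfl le_rfl hs ht.1 n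

theorem fourier_coeff_zero_zeta1 (s : ℂ) (h0 : 0 < s.re) (h1 : s.re < 1) :
    ∫ α in (0:ℝ)..1, (hurwitzZeta (α : UnitAddCircle) s - (α : ℂ) ^ (-s)) = 1 / (s - 1) := by
  have hs : s ≠ 1 := by rintro rfl; simp at h1
  have hcongr : ∫ α in (0:ℝ)..1, (hurwitzZeta (α : UnitAddCircle) s - (α : ℂ) ^ (-s)) =
      ∫ α in (0:ℝ)..1, (∑' n : ℕ, cpowSubIntegral s (n + 1 + α)
        - ((1 + α : ℝ) : ℂ) ^ (1 - s) / (1 - s)) := by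
    refine intervalIntegral.integral_congr_ae (.of_forall fun α hα ↦ ?_)
    rw [uIoc_of_le zero_le_one] at hα
    rw [hurwitzZeta_eq_of_re_pos_of_re_lt_one h0 h1 hα]
    ring
  rw [hcongr, intervalIntegral.integral_sub (intervalIntegrable_tsum_cpowSubIntegral h0 hs)
    ((intervalIntegrable_shift_cpow _ one_pos).div_const _), intervalIntegral.integral_div,
    integral_tsum_cpowSubIntegral h0 hs, cpowSubMean, ofReal_one, one_cpow,
    ← neg_sub 1 s, div_neg]
  ring
end

section
/- For a complex number s with Re(s) < 1 and a nonzero integer n, ∫₀¹ ζ(s,α) e^{-2πinα} dα = Γ(1-s) (2πin)^{s-1}, with the principal branch of the logarithm used to define (2πin)^{s-1}. -/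
open HurwitzZeta Complex Real MeasureTheory Set

lemma norm_cexp_two_pi_I_mul (a : ℝ) (m : ℤ) : ‖cexp (2 * π * I * a * m)‖ = 1 := by
  rw [show 2 * π * I * a * m = ((2 * π * a * m : ℝ) : ℂ) * I by push_cast; ring,
    norm_exp_ofReal_mul_I]

lemma norm_cexp_neg_two_pi_I_mul (n : ℤ) (a : ℝ) : ‖cexp (-2 * π * I * n * a)‖ = 1 := by
  rw [show -2 * π * I * n * a = ((-2 * π * n * a : ℝ) : ℂ) * I by push_cast; ring,
    norm_exp_ofReal_mul_I]

/-- The Fourier coefficients of an absolutely convergent Fourier series. -/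
lemma integral_mul_exp_of_hasSum {c : ℤ → ℂ} (hc : Summable (fun m ↦ ‖c m‖)) {F : ℝ → ℂ}
    (hF : ∀ a : ℝ, HasSum (fun m : ℤ ↦ c m * cexp (2 * π * I * a * m)) (F a)) (n : ℤ) :
    ∫ a in (0:ℝ)..1, F a * cexp (-2 * π * I * n * a) = c n := by
  have hint (m : ℤ) : ∫ a in (0:ℝ)..1, c m * cexp (2 * π * I * a * m) * cexp (-2 * π * I * n * a)
      = if m = n then c n else 0 := by
    have (a : ℝ) : c m * cexp (2 * π * I * a * m) * cexp (-2 * π * I * n * a) =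
        c m * cexp ((2 * π * I * (m - n)) * a) := by
      rw [mul_assoc, ← Complex.exp_add]; ring_nf
    simp_rw [this]
    split_ifs with h
    · simp [h]
    · have hne : (2 * π * I * (m - n) : ℂ) ≠ 0 :=
        mul_ne_zero two_pi_I_ne_zero (sub_ne_zero.mpr (by exact_mod_cast h))
      rw [intervalIntegral.integral_const_mul, integral_exp_mul_complex hne]
      have : cexp (2 * π * I * (m - n)) = 1 :=
        Complex.exp_eq_one_iff.mpr ⟨m - n, by push_cast; ring⟩
      simp [this]
  have hs := intervalIntegral.hasSum_integral_of_dominated_convergence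
    (F := fun (m : ℤ) (a : ℝ) ↦ c m * cexp (2 * π * I * a * m) * cexp (-2 * π * I * n * a))
    (f := fun a ↦ F a * cexp (-2 * π * I * n * a)) (a := 0) (b := 1) (μ := volume)
    (fun m _ ↦ ‖c m‖) (fun m ↦ (Continuous.aestronglyMeasurable (by fun_prop)))
    (fun m ↦ .of_forall fun a _ ↦ by rw [norm_mul, norm_mul, norm_cexp_two_pi_I_mul,
      norm_cexp_neg_two_pi_I_mul, mul_one, mul_one])
    (.of_forall fun a _ ↦ hc) (by simp)
    (.of_forall fun a _ ↦ (hF a).mul_right _)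
  simp_rw [hint] at hs
  exact hs.unique (hasSum_ite_eq n (c n))

/-- Fourier coefficients commute with Mellin transforms, for kernels whose `L¹` norm over a period
is controlled. -/
lemma integral_mellin_mul_exp {K : ℝ → ℝ → ℂ}
    (hK : ContinuousOn (Function.uncurry K) (univ ×ˢ Ioi 0)) {p : ℂ} {b C D r : ℝ}
    (hb : b < p.re) (hr : 0 < r)
    (h0 : ∀ t ∈ Ioc (0:ℝ) 1, ∫ a in (0:ℝ)..1, ‖K a t‖ ≤ C * t ^ (-b))
    (h1 : ∀ t : ℝ, 1 < t → ∫ a in (0:ℝ)..1, ‖K a t‖ ≤ D * rexp (-r * t))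
    {c : ℝ → ℂ} (n : ℤ)
    (hc : ∀ t : ℝ, 0 < t → ∫ a in (0:ℝ)..1, K a t * cexp (-2 * π * I * n * a) = c t) :
    IntervalIntegrable (fun a ↦ mellin (K a) p * cexp (-2 * π * I * n * a)) volume 0 1 ∧
    ∫ a in (0:ℝ)..1, mellin (K a) p * cexp (-2 * π * I * n * a) = mellin c p := by
  let F : ℝ × ℝ → ℂ := fun q ↦ (q.2 : ℂ) ^ (p - 1) * K q.1 q.2 * cexp (-2 * π * I * n * q.1)
  have hFc : ContinuousOn F (univ ×ˢ Ioi 0) := by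
    refine ContinuousOn.mul (ContinuousOn.mul ?_ hK) (by fun_prop)
    intro q hq
    have : (q.2 : ℂ) ∈ slitPlane := ofReal_mem_slitPlane.mpr hq.2
    exact (ContinuousAt.cpow (f := fun q : ℝ × ℝ ↦ (q.2 : ℂ)) (g := fun _ ↦ p - 1)
      (by fun_prop) (by fun_prop) this).continuousWithinAt
  have hFm : AEStronglyMeasurable F ((volume.restrict (Ioc 0 1)).prod (volume.restrict (Ioi 0))) := by
    rw [Measure.prod_restrict]
    exact (hFc.mono (prod_mono (subset_univ _) subset_rfl)).aestronglyMeasurable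
      (measurableSet_Ioc.prod measurableSet_Ioi)
  have hKa {t : ℝ} (ht : 0 < t) : Continuous fun a ↦ K a t := by
    rw [← continuousOn_univ]
    exact hK.comp (f := fun a ↦ (a, t)) (by fun_prop) fun a _ ↦ ⟨mem_univ _, ht⟩
  have hFn {t : ℝ} (ht : 0 < t) : ∫ a in Ioc (0:ℝ) 1, ‖F (a, t)‖ =
      t ^ (p.re - 1) * ∫ a in (0:ℝ)..1, ‖K a t‖ := by
    rw [intervalIntegral.integral_of_le zero_le_one, ← integral_const_mul]
    refine integral_congr_ae (.of_forall fun a ↦ ?_)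
    simp only [F, norm_mul, norm_cexp_neg_two_pi_I_mul, norm_cpow_eq_rpow_re_of_pos ht, mul_one, sub_re,
      one_re]
  have hFi : Integrable F ((volume.restrict (Ioc 0 1)).prod (volume.restrict (Ioi 0))) := by
    rw [integrable_prod_iff' hFm]
    constructor
    · refine (ae_restrict_iff' measurableSet_Ioi).mpr (.of_forall fun t (ht : 0 < t) ↦ ?_)
      have := hKa ht
      simp only [F]
      exact ((Continuous.integrableOn_Icc (by fun_prop)).mono_set Ioc_subset_Icc_self)
    · have hm : AEStronglyMeasurable (fun t ↦ ∫ a in Ioc (0:ℝ) 1, ‖F (a, t)‖)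
          (volume.restrict (Ioi 0)) := hFm.norm.prod_swap.integral_prod_right'
      change IntegrableOn _ _ _
      rw [← Ioc_union_Ioi_eq_Ioi zero_le_one]
      refine IntegrableOn.union ?_ ?_
      · have hi : IntegrableOn (fun t : ℝ ↦ C * t ^ (p.re - b - 1)) (Ioc 0 1) := by
          refine Integrable.const_mul ?_ _
          have := (intervalIntegral.intervalIntegrable_rpow' (a := 0) (b := 1)
            (r := p.re - b - 1) (by linarith))
          rwa [intervalIntegrable_iff_integrableOn_Ioc_of_le zero_le_one] at this
        refine Integrable.mono' hi (hm.mono_set Ioc_subset_Ioi_self)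
          ((ae_restrict_iff' measurableSet_Ioc).mpr (.of_forall fun t ht ↦ ?_))
        rw [Real.norm_of_nonneg (by positivity), hFn ht.1,
          show p.re - b - 1 = (p.re - 1) + (-b) by ring, rpow_add ht.1, mul_left_comm]
        exact mul_le_mul_of_nonneg_left (h0 t ht) (rpow_nonneg ht.1.le _)
      · have hi : IntegrableOn (fun t : ℝ ↦ D * (t ^ (p.re - 1) * rexp (-r * t))) (Ioi 1) := by
          refine Integrable.const_mul ?_ _
          refine integrable_of_isBigO_exp_neg (b := r / 2) (by linarith) ?_ ?_
          · refine ContinuousOn.mul (fun t ht ↦ ?_) (by fun_prop)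
            exact (continuousAt_rpow_const _ _ (.inl (zero_lt_one.trans_le ht).ne')).continuousWithinAt
          · have := (isLittleO_rpow_exp_pos_mul_atTop (p.re - 1) (half_pos hr)).isBigO.mul
              (Asymptotics.isBigO_refl (fun t ↦ rexp (-r * t)) Filter.atTop)
            refine this.congr_right fun t ↦ ?_
            rw [← Real.exp_add]; ring_nf
        refine Integrable.mono' hi (hm.mono_set (Ioi_subset_Ioi zero_le_one))
          ((ae_restrict_iff' measurableSet_Ioi).mpr (.of_forall fun t (ht : 1 < t) ↦ ?_))
        have ht0 : 0 < t := by linarith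
        rw [Real.norm_of_nonneg (by positivity), hFn ht0, mul_left_comm]
        exact mul_le_mul_of_nonneg_left (h1 t ht) (rpow_nonneg ht0.le _)
  have hin (a : ℝ) : ∫ t in Ioi 0, F (a, t) = mellin (K a) p * cexp (-2 * π * I * n * a) := by
    simp only [F, mellin, smul_eq_mul]
    rw [← integral_mul_const]
  constructor
  · rw [intervalIntegrable_iff_integrableOn_Ioc_of_le zero_le_one]
    have := hFi.integral_prod_left
    simpa only [hin, IntegrableOn] using this
  · rw [intervalIntegral.integral_of_le zero_le_one]
    simp_rw [← hin]
    rw [integral_integral_swap (f := fun a t ↦ F (a, t)) hFi]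
    refine setIntegral_congr_fun measurableSet_Ioi fun t (ht : 0 < t) ↦ ?_
    simp only [F, mul_assoc, smul_eq_mul]
    rw [integral_const_mul, ← hc t ht, intervalIntegral.integral_of_le zero_le_one]
    simp only [mul_assoc]

lemma completedCosZeta_eq_mellin {a : UnitAddCircle} (ha : a ≠ 0) {s : ℂ} (hs : 0 < s.re) :
    completedCosZeta a s = mellin (fun t ↦ (cosKernel a t : ℂ) - 1) (s / 2) / 2 := by
  have hs2 : 0 < (s / 2).re := by rw [div_ofNat_re]; positivity
  set P := (hurwitzEvenFEPair a).symm with hP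
  have hf₀ : P.f₀ = 1 := rfl
  have hg₀ : P.g₀ = 0 := if_neg ha
  have hf : P.f = fun t ↦ (cosKernel a t : ℂ) := rfl
  obtain ⟨h1, h2⟩ := hasMellin_one_Ioc hs2
  have h3 : MellinConvergent P.f_modif (s / 2) :=
    (P.isStrongFEPair_toStrongFEPair.hasMellin (s / 2)).1
  have h4 : P.Λ (s / 2) = mellin
      (fun t ↦ P.f_modif t - (Ioc 0 1).indicator (fun _ ↦ (1 : ℂ)) t) (s / 2) := by
    rw [(hasMellin_sub h3 h1).2, h2, WeakFEPair.Λ, WeakFEPair.Λ₀, hf₀, hg₀]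
    simp
  rw [completedCosZeta, ← hP, h4]
  congr 1
  refine integral_congr_ae <| (ae_restrict_iff' measurableSet_Ioi).mpr ?_
  filter_upwards [compl_mem_ae_iff.mpr (Subsingleton.measure_zero (s := {(1:ℝ)}) (by simp) _)]
    with t (ht₁ : t ≠ 1) (ht₀ : 0 < t)
  congr 1
  rw [WeakFEPair.f_modif, hf₀, hg₀, hf, Pi.add_apply]
  by_cases ht : t < 1
  · rw [indicator_of_notMem (by grind), indicator_of_mem (by grind), indicator_of_mem (by grind)]
    simp
  · rw [indicator_of_mem (by grind), indicator_of_notMem (by grind),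
      indicator_of_notMem (by grind)]
    simp

lemma completedSinZeta_eq_mellin (a : UnitAddCircle) (s : ℂ) :
    completedSinZeta a s = mellin (fun t ↦ (sinKernel a t : ℂ)) ((s + 1) / 2) / 2 := by
  rw [completedSinZeta, (isStrong_hurwitzOddFEPair a).symm_Λ_eq]
  rfl

lemma one_div_pi_mul_sq_cpow {N : ℝ} (hN : 0 < N) (a : ℂ) :
    (1 / ((π * N ^ 2 : ℝ) : ℂ)) ^ a = (π : ℂ) ^ (-a) * (N : ℂ) ^ (-(2 * a)) := by
  have h : (1 / ((π * N ^ 2 : ℝ) : ℂ)) = ((1 / (π * N ^ 2) : ℝ) : ℂ) := by push_cast; rfl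
  rw [h, cpow_def_of_ne_zero (ofReal_ne_zero.mpr (by positivity)),
    cpow_def_of_ne_zero (ofReal_ne_zero.mpr pi_ne_zero),
    cpow_def_of_ne_zero (ofReal_ne_zero.mpr hN.ne'), ← Complex.exp_add,
    ← ofReal_log (by positivity), ← ofReal_log hN.le, ← ofReal_log pi_pos.le, one_div,
    Real.log_inv, Real.log_mul pi_ne_zero (by positivity), Real.log_pow]
  push_cast
  ring_nf

lemma mellin_exp_neg_pi_mul_sq {N : ℝ} (hN : 0 < N) {p : ℂ} (hp : 0 < p.re) :
    mellin (fun t ↦ cexp (-((π * N ^ 2 : ℝ) * t))) p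
      = (π : ℂ) ^ (-p) * (N : ℂ) ^ (-(2 * p)) * Complex.Gamma p := by
  rw [← one_div_pi_mul_sq_cpow hN,
    ← integral_cpow_mul_exp_neg_mul_Ioi hp (r := π * N ^ 2) (by positivity)]
  rfl

lemma exp_neg_pi_mul_sq_le {m : ℤ} (hm : m ≠ 0) {t : ℝ} (ht : 1 ≤ t) :
    rexp (-π * m ^ 2 * t) ≤ rexp (-π * m ^ 2 * (1 / 2)) * rexp (-(π / 2) * t) := by
  rw [← Real.exp_add, Real.exp_le_exp]
  have h1 : (1 : ℝ) ≤ (m : ℝ) ^ 2 := by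
    exact_mod_cast Int.one_le_abs (pow_ne_zero 2 hm) |>.trans_eq (abs_of_nonneg (sq_nonneg m))
  nlinarith [mul_nonneg pi_pos.le (add_nonneg (mul_nonneg (zero_le_one.trans h1)
    (sub_nonneg.mpr ht)) (mul_nonneg (zero_le_one.trans ht) (sub_nonneg.mpr h1)))]

lemma UnitAddCircle.coe_ne_zero_of_mem_Ioo {a : ℝ} (ha : a ∈ Set.Ioo (0:ℝ) 1) :
    (a : UnitAddCircle) ≠ 0 := by
  intro h
  rw [AddCircle.coe_eq_zero_iff] at h
  obtain ⟨k, hk⟩ := h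
  simp only [zsmul_eq_mul, mul_one] at hk
  rw [← hk] at ha
  have h1 : 0 < k := by exact_mod_cast ha.1
  have h2 : k < 1 := by exact_mod_cast ha.2
  omega

/-- Evaluation of the combination of Gamma factors produced by the even and odd parts of the
Hurwitz zeta function. -/
lemma Gammaℝ_add_Gammaℝ_eq {w : ℂ} (hw : 0 < w.re) {n : ℤ} (hn : n ≠ 0) :
    Gammaℝ w * ((|(n : ℝ)| : ℝ) : ℂ) ^ (-w) / 2 / Gammaℝ (1 - w)
      + -I * n.sign * Gammaℝ (w + 1) * ((|(n : ℝ)| : ℝ) : ℂ) ^ (-w) / 2 / Gammaℝ (2 - w)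
      = Complex.Gamma w * (2 * π * I * (n : ℂ)) ^ (-w) := by
  have hN : 0 < |(n : ℝ)| := by positivity
  have hw' (k : ℕ) : w ≠ -k := by
    rintro rfl
    simp only [neg_re, natCast_re] at hw
    linarith [(Nat.cast_nonneg k : (0:ℝ) ≤ k)]
  have g1 := Gammaℝ_ne_zero_of_re_pos hw
  have g2 : Gammaℝ (w + 1) ≠ 0 := Gammaℝ_ne_zero_of_re_pos (by simp; linarith)
  have hlhs : Gammaℝ w * ((|(n : ℝ)| : ℝ) : ℂ) ^ (-w) / 2 / Gammaℝ (1 - w)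
      + -I * n.sign * Gammaℝ (w + 1) * ((|(n : ℝ)| : ℝ) : ℂ) ^ (-w) / 2 / Gammaℝ (2 - w)
      = Complex.Gamma w * ((2 * π) ^ (-w) * ((|(n : ℝ)| : ℝ) : ℂ) ^ (-w) *
        (Complex.cos (π * w / 2) - n.sign * Complex.sin (π * w / 2) * I)) := by
    rw [div_eq_mul_inv _ (Gammaℝ (1 - w)), div_eq_mul_inv _ (Gammaℝ (2 - w)),
      inv_Gammaℝ_one_sub hw', inv_Gammaℝ_two_sub hw', Gammaℂ_def]
    field_simp
    ring
  rw [hlhs]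
  congr 1
  have h2pi : (2 * π : ℂ) ≠ 0 := by exact_mod_cast two_pi_pos.ne'
  have hl2pi : Complex.log (2 * π) = Real.log (2 * π) := by
    rw [ofReal_log two_pi_pos.le]; push_cast; rfl
  have hn' : (n : ℂ) ≠ 0 := by exact_mod_cast hn
  rw [cpow_def_of_ne_zero h2pi, cpow_def_of_ne_zero (ofReal_ne_zero.mpr hN.ne'),
    cpow_def_of_ne_zero (mul_ne_zero two_pi_I_ne_zero hn'), ← ofReal_log hN.le, hl2pi,
    ← Complex.exp_add]
  rcases hn.lt_or_gt with h | h
  · have hab : |(n : ℝ)| = -n := by rw [abs_of_neg (by exact_mod_cast h)]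
    have harg : (2 * π * I * n : ℂ) = ((2 * π * |(n : ℝ)| : ℝ) : ℂ) * (-I) := by
      rw [hab]; push_cast; ring
    rw [harg, log_ofReal_mul (by positivity) (by simp), log_neg_I, Int.sign_eq_neg_one_of_neg h,
      Real.log_mul two_pi_pos.ne' hN.ne']
    have := Complex.exp_mul_I (π * w / 2)
    push_cast
    rw [show Complex.cos (π * w / 2) - -1 * Complex.sin (π * w / 2) * I =
      cexp (π * w / 2 * I) by rw [this]; ring, ← Complex.exp_add]
    ring_nf
  · have hab : |(n : ℝ)| = n := by rw [abs_of_pos (by exact_mod_cast h)]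
    have harg : (2 * π * I * n : ℂ) = ((2 * π * |(n : ℝ)| : ℝ) : ℂ) * I := by
      rw [hab]; push_cast; ring
    rw [harg, log_ofReal_mul (by positivity) (by simp), log_I, Int.sign_eq_one_of_pos h,
      Real.log_mul two_pi_pos.ne' hN.ne']
    have := Complex.exp_mul_I (-(π * w / 2))
    rw [Complex.cos_neg, Complex.sin_neg] at this
    push_cast
    rw [show Complex.cos (π * w / 2) - 1 * Complex.sin (π * w / 2) * I =
      cexp (-(π * w / 2) * I) by rw [this]; ring, ← Complex.exp_add]
    ring_nf

lemma continuousOn_cosKernel_prod :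
    ContinuousOn (fun q : ℝ × ℝ ↦ (cosKernel (q.1 : UnitAddCircle) q.2 : ℂ)) (univ ×ˢ Ioi 0) := by
  intro q hq
  have hq2 : 0 < (I * (q.2 : ℂ)).im := by simpa using hq.2
  simp only [cosKernel_def]
  exact ((continuousAt_jacobiTheta₂ (q.1 : ℂ) hq2).comp
    (f := fun q : ℝ × ℝ ↦ ((q.1 : ℂ), I * (q.2 : ℂ)))
    (by fun_prop)).continuousWithinAt

lemma continuousOn_sinKernel_prod :
    ContinuousOn (fun q : ℝ × ℝ ↦ (sinKernel (q.1 : UnitAddCircle) q.2 : ℂ)) (univ ×ˢ Ioi 0) := by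
  intro q hq
  have hq2 : 0 < (I * (q.2 : ℂ)).im := by simpa using hq.2
  simp only [sinKernel_def]
  exact (((continuousAt_jacobiTheta₂' (q.1 : ℂ) hq2).comp
    (f := fun q : ℝ × ℝ ↦ ((q.1 : ℂ), I * (q.2 : ℂ)))
    (by fun_prop)).div_const _).continuousWithinAt

lemma cosKernel_nonneg (a : ℝ) {t : ℝ} (ht : 0 < t) : 0 ≤ cosKernel a t := by
  have h := evenKernel_functional_equation a (1 / t)
  rw [one_div_one_div] at h
  have h1 : 0 ≤ evenKernel a (1 / t) :=
    (hasSum_int_evenKernel a (one_div_pos.mpr ht)).nonneg fun _ ↦ (Real.exp_pos _).le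
  rw [h] at h1
  exact (mul_nonneg_iff_of_pos_left (by positivity)).mp h1

lemma summable_exp_neg_pi_mul_sq {t : ℝ} (ht : 0 < t) :
    Summable fun m : ℤ ↦ rexp (-π * m ^ 2 * t) := by
  simpa using (hasSum_int_evenKernel 0 ht).summable

lemma summable_abs_mul_exp_neg_pi_mul_sq {t : ℝ} (ht : 0 < t) :
    Summable fun m : ℤ ↦ |(m : ℝ)| * rexp (-π * m ^ 2 * t) := by
  simpa [abs_mul] using (hasSum_int_oddKernel 0 ht).summable.abs

lemma integral_cosKernel {t : ℝ} (ht : 0 < t) : ∫ a in (0:ℝ)..1, cosKernel a t = 1 := by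
  have h := integral_mul_exp_of_hasSum (c := fun m : ℤ ↦ (rexp (-π * m ^ 2 * t) : ℂ))
    (F := fun a ↦ (cosKernel a t : ℂ))
    (by simpa only [norm_real] using (summable_exp_neg_pi_mul_sq ht).norm)
    (fun a ↦ by simpa only [mul_comm] using hasSum_int_cosKernel a ht) 0
  have h' : ∫ a in (0:ℝ)..1, (cosKernel a t : ℂ) = ((1 : ℝ) : ℂ) := by simpa using h
  rw [intervalIntegral.integral_ofReal] at h'
  exact_mod_cast h'

lemma continuous_cosKernel_left {t : ℝ} (ht : 0 < t) :
    Continuous fun a : ℝ ↦ cosKernel (a : UnitAddCircle) t := by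
  have h : Continuous fun a : ℝ ↦ (cosKernel (a : UnitAddCircle) t : ℂ) := by
    rw [← continuousOn_univ]
    exact continuousOn_cosKernel_prod.comp (f := fun a ↦ (a, t)) (by fun_prop)
      fun a _ ↦ ⟨mem_univ _, ht⟩
  exact (continuous_re.comp h).congr fun a ↦ ofReal_re _

lemma integral_norm_le_of_hasSum {c : ℤ → ℂ} {B : ℤ → ℝ} {S : ℝ} (hB : HasSum B S)
    (hcB : ∀ m, ‖c m‖ ≤ B m) {F : ℝ → ℂ}
    (hF : ∀ a : ℝ, HasSum (fun m : ℤ ↦ c m * cexp (2 * π * I * a * m)) (F a)) :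
    ∫ a in (0:ℝ)..1, ‖F a‖ ≤ S := by
  have h := intervalIntegral.norm_integral_le_of_norm_le_const (a := 0) (b := 1) (C := S)
    (f := fun a ↦ ‖F a‖) fun a _ ↦ by
      rw [norm_norm, ← (hF a).tsum_eq]
      refine tsum_of_norm_bounded hB fun m ↦ ?_
      rw [norm_mul, norm_cexp_two_pi_I_mul, mul_one]
      exact hcB m
  rw [sub_zero, abs_one, mul_one] at h
  exact (le_abs_self _).trans h

/-- The Fourier coefficients of the completed cosine zeta function, in the half-plane
`0 < re w`. -/
lemma integral_completedCosZeta_mul_exp {w : ℂ} (hw : 0 < w.re) {n : ℤ} (hn : n ≠ 0) :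
    IntervalIntegrable (fun a : ℝ ↦ completedCosZeta a w * cexp (-2 * π * I * n * a)) volume 0 1 ∧
    ∫ a in (0:ℝ)..1, completedCosZeta a w * cexp (-2 * π * I * n * a)
      = Gammaℝ w * (|(n : ℝ)| : ℝ) ^ (-w) / 2 := by
  have hw2 : 0 < (w / 2).re := by rw [div_ofNat_re]; positivity
  let c (t : ℝ) (m : ℤ) : ℂ := if m = 0 then 0 else (rexp (-π * m ^ 2 * t) : ℂ)
  have hcn (t : ℝ) (m : ℤ) : ‖c t m‖ ≤ rexp (-π * m ^ 2 * t) := by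
    simp only [c]
    split_ifs
    · simpa using (Real.exp_pos _).le
    · rw [norm_real, Real.norm_of_nonneg (Real.exp_pos _).le]
  have hsum {t : ℝ} (ht : 0 < t) (a : ℝ) :
      HasSum (fun m : ℤ ↦ c t m * cexp (2 * π * I * a * m)) ((cosKernel a t : ℂ) - 1) := by
    refine (hasSum_int_cosKernel₀ a ht).congr_fun fun m ↦ ?_
    simp only [c]
    split_ifs
    · simp
    · rw [mul_comm]
  have key := integral_mellin_mul_exp (K := fun a t ↦ (cosKernel (a : UnitAddCircle) t : ℂ) - 1)
    (continuousOn_cosKernel_prod.sub continuousOn_const) (p := w / 2) (b := 0) (C := 2)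
    (D := ∑' m : ℤ, rexp (-π * m ^ 2 * (1 / 2))) hw2 (half_pos pi_pos) ?_ ?_
    (c := fun t ↦ cexp (-((π * |(n : ℝ)| ^ 2 : ℝ) * t))) n ?_
  · have hae : ∀ᵐ a : ℝ, a ∈ uIoc (0:ℝ) 1 →
        mellin (fun t ↦ (cosKernel (a : UnitAddCircle) t : ℂ) - 1) (w / 2) *
          cexp (-2 * π * I * n * a) * (1 / 2)
        = completedCosZeta a w * cexp (-2 * π * I * n * a) := by
      filter_upwards [compl_mem_ae_iff.mpr (Subsingleton.measure_zero (s := {(1:ℝ)}) (by simp) _)]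
        with a (ha : a ≠ 1) ha'
      rw [uIoc_of_le zero_le_one] at ha'
      rw [completedCosZeta_eq_mellin
        (UnitAddCircle.coe_ne_zero_of_mem_Ioo ⟨ha'.1, lt_of_le_of_ne ha'.2 ha⟩) hw]
      ring
    refine ⟨(key.1.mul_const (1 / 2)).congr_ae ?_, ?_⟩
    · exact (ae_restrict_iff' measurableSet_uIoc).mpr hae
    · rw [← intervalIntegral.integral_congr_ae hae, intervalIntegral.integral_mul_const, key.2,
        mellin_exp_neg_pi_mul_sq (by positivity) hw2, Gammaℝ_def]
      ring_nf
  · intro t ht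
    have hc := continuous_cosKernel_left ht.1
    calc ∫ a in (0:ℝ)..1, ‖(cosKernel (a : UnitAddCircle) t : ℂ) - 1‖
      _ ≤ ∫ a in (0:ℝ)..1, (cosKernel (a : UnitAddCircle) t + 1) := by
        refine intervalIntegral.integral_mono_on zero_le_one
          (Continuous.intervalIntegrable (by fun_prop) _ _)
          (Continuous.intervalIntegrable (by fun_prop) _ _) fun a _ ↦ ?_
        refine (norm_sub_le _ _).trans_eq ?_
        rw [norm_real, Real.norm_of_nonneg (cosKernel_nonneg a ht.1), norm_one]
      _ = 2 * t ^ (-(0:ℝ)) := by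
        rw [intervalIntegral.integral_add (hc.intervalIntegrable _ _) (by simp),
          integral_cosKernel ht.1]
        norm_num
  · intro t ht
    refine integral_norm_le_of_hasSum
      ((summable_exp_neg_pi_mul_sq one_half_pos).hasSum.mul_right _) (fun m ↦ ?_)
      (hsum (zero_lt_one.trans ht))
    by_cases hm : m = 0
    · simp only [c, hm, if_true, norm_zero]
      positivity
    · exact (hcn t m).trans (exp_neg_pi_mul_sq_le hm ht.le)
  · intro t ht
    rw [integral_mul_exp_of_hasSum ((summable_exp_neg_pi_mul_sq ht).of_nonneg_of_le
      (fun _ ↦ norm_nonneg _) (hcn t)) (hsum ht) n]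
    simp [c, hn, sq_abs]

/-- The `L¹` norm of the odd Hurwitz kernel over a period. -/
lemma integral_abs_oddKernel_le {u : ℝ} (hu : 0 < u) :
    ∫ a in (0:ℝ)..1, |oddKernel a u| ≤ (∫ x : ℝ, |x| * rexp (-π * x ^ 2)) / u := by
  let g (x : ℝ) : ℝ := |x| * rexp (-π * x ^ 2 * u)
  have hg0 (x : ℝ) : 0 ≤ g x := by positivity
  have hg : Integrable g := by
    refine (integrable_mul_exp_neg_mul_sq (b := π * u) (by positivity)).norm.congr
      (.of_forall fun x ↦ ?_)
    simp only [g, norm_mul, Real.norm_eq_abs, Real.abs_exp]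
    ring_nf
  have hgi : ∫ x, g x = (∫ x : ℝ, |x| * rexp (-π * x ^ 2)) / u := by
    have hs : 0 < √u := Real.sqrt_pos.mpr hu
    have := Measure.integral_comp_mul_left (fun x : ℝ ↦ |x| * rexp (-π * x ^ 2)) (√u)
    have h2 (x : ℝ) : |√u * x| * rexp (-π * (√u * x) ^ 2) = √u * g x := by
      simp only [g]
      rw [abs_mul, abs_of_pos hs, mul_pow, Real.sq_sqrt hu.le]
      ring_nf
    simp_rw [h2] at this
    rw [integral_const_mul, abs_of_pos (inv_pos.mpr hs), smul_eq_mul] at this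
    rw [eq_div_iff hu.ne']
    calc (∫ x, g x) * u = √u * (√u * ∫ x, g x) := by
          rw [← mul_assoc, Real.mul_self_sqrt hu.le, mul_comm]
      _ = _ := by rw [this, mul_inv_cancel_left₀ hs.ne']
  have hpos : 0 < ∫ x, g x := by
    refine (integral_pos_iff_support_of_nonneg hg0 hg).mpr
      (lt_of_lt_of_le ?_ (measure_mono (s := Ioi 0) fun x (hx : 0 < x) ↦ ?_))
    · simp
    · exact (mul_pos (abs_pos.mpr hx.ne') (Real.exp_pos _)).ne'
  have hci (n : ℤ) : Integrable (fun a : ℝ ↦ g (a + n)) (volume.restrict (Ioc 0 1)) :=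
    (hg.comp_add_right (n : ℝ)).integrableOn
  have hsum := hg.hasSum_intervalIntegral_comp_add_int
  simp_rw [intervalIntegral.integral_of_le zero_le_one] at hsum ⊢
  have hS : ∫ a in Ioc (0:ℝ) 1, ∑' n : ℤ, g (a + n) = ∫ x, g x := by
    refine (hasSum_integral_of_summable_integral_norm hci ?_).unique hsum
    simpa only [Real.norm_of_nonneg (hg0 _)] using hsum.summable
  have hle (a : ℝ) : |oddKernel a u| ≤ ∑' n : ℤ, g (a + n) := by
    have h := hasSum_int_oddKernel a hu
    rw [← h.tsum_eq]
    refine (norm_tsum_le_tsum_norm h.summable.norm).trans_eq (tsum_congr fun n ↦ ?_)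
    simp only [g, norm_mul, Real.norm_eq_abs, Real.abs_exp, add_comm]
  have hI : Integrable (fun a : ℝ ↦ ∑' n : ℤ, g (a + n)) (volume.restrict (Ioc 0 1)) :=
    Integrable.of_integral_ne_zero (hS.trans_ne hpos.ne')
  exact (integral_mono_of_nonneg (.of_forall fun _ ↦ abs_nonneg _) hI (.of_forall hle)).trans_eq
    (hS.trans hgi)

lemma sinKernel_eq_rpow_mul_oddKernel (a : UnitAddCircle) {t : ℝ} (ht : 0 < t) :
    sinKernel a t = t ^ (-(3 / 2) : ℝ) * oddKernel a (1 / t) := by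
  have h := oddKernel_functional_equation a (1 / t)
  rw [one_div_one_div] at h
  rw [h, Real.rpow_neg ht.le, one_div t, Real.inv_rpow ht.le]
  field_simp

/-- The Fourier coefficients of the completed sine zeta function, in the half-plane
`0 < re w`. -/
lemma integral_completedSinZeta_mul_exp {w : ℂ} (hw : 0 < w.re) {n : ℤ} (hn : n ≠ 0) :
    IntervalIntegrable (fun a : ℝ ↦ completedSinZeta a w * cexp (-2 * π * I * n * a)) volume 0 1 ∧
    ∫ a in (0:ℝ)..1, completedSinZeta a w * cexp (-2 * π * I * n * a)
      = -I * n.sign * Gammaℝ (w + 1) * (|(n : ℝ)| : ℝ) ^ (-w) / 2 := by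
  have hw2 : 1 / 2 < ((w + 1) / 2).re := by rw [div_ofNat_re, add_re, one_re]; linarith
  let c (t : ℝ) (m : ℤ) : ℂ := -I * m * (rexp (-π * m ^ 2 * t) : ℂ)
  have hcn (t : ℝ) (m : ℤ) : ‖c t m‖ = |(m : ℝ)| * rexp (-π * m ^ 2 * t) := by
    simp only [c]
    rw [norm_mul, norm_mul, norm_neg, norm_I, one_mul, norm_real,
      Real.norm_of_nonneg (Real.exp_pos _).le, norm_intCast]
  have hsum {t : ℝ} (ht : 0 < t) (a : ℝ) :
      HasSum (fun m : ℤ ↦ c t m * cexp (2 * π * I * a * m)) (sinKernel a t : ℂ) :=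
    (hasSum_int_sinKernel a ht).congr_fun fun m ↦ by simp only [c]; ring
  have key := integral_mellin_mul_exp (K := fun a t ↦ (sinKernel (a : UnitAddCircle) t : ℂ))
    continuousOn_sinKernel_prod (p := (w + 1) / 2) (b := 1 / 2)
    (C := ∫ x : ℝ, |x| * rexp (-π * x ^ 2))
    (D := ∑' m : ℤ, |(m : ℝ)| * rexp (-π * m ^ 2 * (1 / 2))) hw2 (half_pos pi_pos) ?_ ?_
    (c := fun t ↦ (-I * n) • cexp (-((π * |(n : ℝ)| ^ 2 : ℝ) * t))) n ?_
  · have heq : (fun a : ℝ ↦ mellin (fun t ↦ (sinKernel (a : UnitAddCircle) t : ℂ)) ((w + 1) / 2) *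
          cexp (-2 * π * I * n * a) * (1 / 2))
        = fun a : ℝ ↦ completedSinZeta a w * cexp (-2 * π * I * n * a) := by
      funext a
      rw [completedSinZeta_eq_mellin]
      ring
    refine ⟨heq ▸ key.1.mul_const (1 / 2), ?_⟩
    have hn0 : ((|(n : ℝ)| : ℝ) : ℂ) ≠ 0 :=
      ofReal_ne_zero.mpr (abs_pos.mpr (Int.cast_ne_zero.mpr hn)).ne'
    have hsign : (n : ℂ) = n.sign * ((|(n : ℝ)| : ℝ) : ℂ) := by
      have := Int.sign_mul_abs n
      rw [← Int.cast_abs, ofReal_intCast]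
      exact_mod_cast this.symm
    rw [← heq, intervalIntegral.integral_mul_const, key.2, mellin_const_smul, smul_eq_mul,
      mellin_exp_neg_pi_mul_sq (by positivity) (one_half_pos.trans hw2), Gammaℝ_def, hsign,
      show -(2 * ((w + 1) / 2)) = -w - 1 by ring, cpow_sub _ _ hn0, cpow_one]
    field_simp
  · intro t ht
    calc ∫ a in (0:ℝ)..1, ‖(sinKernel (a : UnitAddCircle) t : ℂ)‖
      _ = t ^ (-(3 / 2) : ℝ) * ∫ a in (0:ℝ)..1, |oddKernel a (1 / t)| := by
        rw [← intervalIntegral.integral_const_mul]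
        refine intervalIntegral.integral_congr fun a _ ↦ ?_
        rw [norm_real, Real.norm_eq_abs, sinKernel_eq_rpow_mul_oddKernel _ ht.1, abs_mul,
          abs_of_pos (rpow_pos_of_pos ht.1 _)]
      _ ≤ t ^ (-(3 / 2) : ℝ) * ((∫ x : ℝ, |x| * rexp (-π * x ^ 2)) / (1 / t)) :=
        mul_le_mul_of_nonneg_left (integral_abs_oddKernel_le (one_div_pos.mpr ht.1))
          (rpow_nonneg ht.1.le _)
      _ = (∫ x : ℝ, |x| * rexp (-π * x ^ 2)) * t ^ (-(1 / 2) : ℝ) := by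
        rw [show (-(1 / 2) : ℝ) = -(3 / 2) + 1 by norm_num, rpow_add_one ht.1.ne']
        field_simp
  · intro t ht
    refine integral_norm_le_of_hasSum
      ((summable_abs_mul_exp_neg_pi_mul_sq one_half_pos).hasSum.mul_right _) (fun m ↦ ?_)
      (hsum (zero_lt_one.trans ht))
    rw [hcn]
    by_cases hm : m = 0
    · simp [hm]
    · exact (mul_le_mul_of_nonneg_left (exp_neg_pi_mul_sq_le hm ht.le) (abs_nonneg _)).trans_eq
        (mul_assoc _ _ _).symm
  · intro t ht
    rw [integral_mul_exp_of_hasSum (by simpa only [hcn] using summable_abs_mul_exp_neg_pi_mul_sq ht)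
      (hsum ht) n]
    simp [c, sq_abs]

theorem fourier_coeff_hurwitzZeta (s : ℂ) (hs : s.re < 1) (n : ℤ) (hn : n ≠ 0) :
    ∫ α in (0:ℝ)..1, hurwitzZeta (α : UnitAddCircle) s * Complex.exp (-2 * π * I * n * α)
      = Complex.Gamma (1 - s) * (2 * π * I * (n : ℂ)) ^ (s - 1) := by
  have hw : 0 < (1 - s).re := by rw [sub_re, one_re]; linarith
  obtain ⟨he1, he2⟩ := integral_completedCosZeta_mul_exp hw hn
  obtain ⟨ho1, ho2⟩ := integral_completedSinZeta_mul_exp hw hn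
  have hae : ∀ᵐ a : ℝ, a ∈ uIoc (0:ℝ) 1 →
      hurwitzZeta (a : UnitAddCircle) s * cexp (-2 * π * I * n * a) =
      completedCosZeta a (1 - s) * cexp (-2 * π * I * n * a) / Gammaℝ s +
      completedSinZeta a (1 - s) * cexp (-2 * π * I * n * a) / Gammaℝ (s + 1) := by
    filter_upwards [compl_mem_ae_iff.mpr (Subsingleton.measure_zero (s := {(1:ℝ)}) (by simp) _)]
      with a (ha : a ≠ 1) ha'
    rw [uIoc_of_le zero_le_one] at ha'
    rw [hurwitzZeta, hurwitzZetaOdd, hurwitzZetaEven_def_of_ne_or_ne (.inl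
      (UnitAddCircle.coe_ne_zero_of_mem_Ioo ⟨ha'.1, lt_of_le_of_ne ha'.2 ha⟩)),
      completedCosZeta_one_sub, completedSinZeta_one_sub]
    ring
  rw [intervalIntegral.integral_congr_ae hae,
    intervalIntegral.integral_add (he1.div_const _) (ho1.div_const _),
    intervalIntegral.integral_div, intervalIntegral.integral_div, he2, ho2]
  have := Gammaℝ_add_Gammaℝ_eq hw hn
  rw [sub_sub_cancel, show 2 - (1 - s) = s + 1 by ring] at this
  rw [this, neg_sub]
end

section
/- For a real number σ < 1/2 with s = σ real, ∫₀¹ |ζ(s,α)|² dα = 2^{2σ-1} π^{2σ-2} |Γ(1-s)|² ζ(2-2σ) · (a constant depending on s), and in particular the left-hand side equals |Γ(1-s)|² Σ_{n∈ℤ, n≠0} |(2πin)^{s-1}|². -/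
open HurwitzZeta Complex Real

open Filter Topology MeasureTheory AddCircle

/-- Parseval's identity for a function that is the pointwise limit almost everywhere of absolutely
convergent Fourier series whose coefficients converge, dominated by a square-summable limit. -/
theorem integral_norm_sq_eq_tsum_of_tendsto {T : ℝ} [Fact (0 < T)] {f : AddCircle T → ℂ}
    {c : ℤ → ℂ} {b : ℕ → ℤ → ℂ} (hc : Summable fun n ↦ ‖c n‖ ^ 2) (hb : ∀ K, Summable (b K))
    (hle : ∀ K n, ‖b K n‖ ≤ ‖c n‖) (hlim : ∀ n, Tendsto (b · n) atTop (𝓝 (c n)))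
    (hf : ∀ᵐ x ∂(haarAddCircle (T := T)),
      Tendsto (fun K ↦ ∑' n, b K n * fourier n x) atTop (𝓝 (f x))) :
    ∫ x, ‖f x‖ ^ 2 ∂(haarAddCircle (T := T)) = ∑' n, ‖c n‖ ^ 2 := by
  have two : (2 : ENNReal).toReal = 2 := by simp
  have hcmem : Memℓp c 2 := memℓp_gen (by simpa [two] using hc)
  have hbmem (K : ℕ) : Memℓp (b K) 2 := memℓp_gen <| by
    simpa [two] using hc.of_nonneg_of_le (fun n ↦ sq_nonneg ‖b K n‖)
      fun n ↦ pow_le_pow_left₀ (norm_nonneg _) (hle K n) 2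
  let cl : lp (fun _ : ℤ ↦ ℂ) 2 := ⟨c, hcmem⟩
  let bl (K : ℕ) : lp (fun _ : ℤ ↦ ℂ) 2 := ⟨b K, hbmem K⟩
  have hsq (u : lp (fun _ : ℤ ↦ ℂ) 2) : ‖u‖ ^ 2 = ∑' n, ‖u n‖ ^ 2 := by
    simpa [two] using lp.norm_rpow_eq_tsum (p := 2) (by simp) u
  have hbl : Tendsto bl atTop (𝓝 cl) := by
    rw [tendsto_iff_norm_sub_tendsto_zero]
    have h : Tendsto (fun K ↦ ‖bl K - cl‖ ^ 2) atTop (𝓝 0) := by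
      simp_rw [hsq]
      have := tendsto_tsum_of_dominated_convergence (f := fun K n ↦ ‖(bl K - cl) n‖ ^ 2)
        (g := fun _ ↦ (0 : ℝ)) (𝓕 := atTop) (hc.mul_left 4) (fun n ↦ ?_) (.of_forall fun K n ↦ ?_)
      · simpa using this
      · simpa using ((tendsto_iff_norm_sub_tendsto_zero.mp (hlim n)).pow 2)
      · have : ‖b K n - c n‖ ≤ 2 * ‖c n‖ := (norm_sub_le _ _).trans (by linarith [hle K n])
        calc ‖‖b K n - c n‖ ^ 2‖ = ‖b K n - c n‖ ^ 2 := by simp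
          _ ≤ (2 * ‖c n‖) ^ 2 := by gcongr
          _ = _ := by ring
    simpa using h.sqrt
  let G := (fourierBasis (T := T)).repr.symm cl
  have hG : Tendsto (fun K ↦ fourierBasis.repr.symm (bl K)) atTop (𝓝 G) :=
    (fourierBasis.repr.symm.continuous.tendsto _).comp hbl
  have hser (K : ℕ) :
      (fourierBasis (T := T)).repr.symm (bl K) =ᵐ[haarAddCircle]
        fun x ↦ ∑' n, b K n * fourier n x := by
    have hs : Summable fun n ↦ b K n • fourier (T := T) n :=
      .of_norm <| by simpa [norm_smul, fourier_norm] using (hb K).norm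
    have h1 := ((ContinuousMap.toLp 2 (haarAddCircle (T := T)) ℂ).hasSum hs.hasSum)
    have h2 := (fourierBasis (T := T)).hasSum_repr_symm (bl K)
    rw [coe_fourierBasis] at h2
    have h3 : (fourierBasis (T := T)).repr.symm (bl K) = _ :=
      h2.unique (by simpa [Function.comp_def, fourierLp] using h1)
    rw [h3]
    filter_upwards [ContinuousMap.coeFn_toLp (p := 2) (𝕜 := ℂ) (haarAddCircle (T := T))
      (∑' n, b K n • fourier (T := T) n)] with x hx
    rw [hx, ← ContinuousMap.tsum_apply hs]
    simp
  have hm := tendstoInMeasure_of_tendsto_Lp hG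
  obtain ⟨φ, hφ, hae⟩ := hm.exists_seq_tendsto_ae
  have hfG : ∀ᵐ x ∂(haarAddCircle (T := T)), f x = G x := by
    filter_upwards [hae, hf, ae_all_iff.mpr hser] with x h1 h2 h3
    simp_rw [h3] at h1
    exact tendsto_nhds_unique (h2.comp hφ.tendsto_atTop) h1
  rw [integral_congr_ae (g := fun x ↦ ‖G x‖ ^ 2) (by filter_upwards [hfG] with x hx; rw [hx]),
    ← tsum_sq_fourierCoeff]
  simp_rw [← fourierBasis_repr]
  simp [G, cl]

lemma ae_haarAddCircle_ne_zero {T : ℝ} [Fact (0 < T)] :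
    ∀ᵐ x ∂(haarAddCircle (T := T)), x ≠ 0 := by
  have hT : 0 < T := Fact.out
  have h := AddCircle.volume_closedBall T (x := 0) 0
  rw [Metric.closedBall_zero, volume_eq_smul_haarAddCircle] at h
  simpa [ae_iff, hT.not_ge] using h

/-- `n ^ (-(w + 1))` times the `K`-th Taylor partial sum of `exp (log n)`; these numbers
increase to `n ^ (-w)` as `K → ∞`. -/
noncomputable def rpowTaylor (w : ℝ) (K n : ℕ) : ℝ :=
  (n : ℝ) ^ (-(w + 1)) * ∑ k ∈ Finset.range K, Real.log n ^ k / k.factorial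

lemma rpowTaylor_nonneg (w : ℝ) (K n : ℕ) : 0 ≤ rpowTaylor w K n :=
  mul_nonneg (by positivity) <| Finset.sum_nonneg fun k _ ↦
    div_nonneg (pow_nonneg (Real.log_natCast_nonneg n) k) (by positivity)

lemma rpow_neg_add_one_mul_exp_log {w : ℝ} (hw : 0 < w) (n : ℕ) :
    (n : ℝ) ^ (-(w + 1)) * rexp (Real.log n) = (n : ℝ) ^ (-w) := by
  rcases n.eq_zero_or_pos with rfl | hn
  · simp [Real.zero_rpow (by linarith : -1 + -w ≠ 0), Real.zero_rpow (neg_ne_zero.mpr hw.ne')]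
  · have hn' : (0 : ℝ) < n := by exact_mod_cast hn
    rw [Real.exp_log hn', ← Real.rpow_add_one hn'.ne']
    ring_nf

lemma rpowTaylor_le {w : ℝ} (hw : 0 < w) (K n : ℕ) : rpowTaylor w K n ≤ (n : ℝ) ^ (-w) := by
  rw [← rpow_neg_add_one_mul_exp_log hw]
  exact mul_le_mul_of_nonneg_left (Real.sum_le_exp_of_nonneg (Real.log_natCast_nonneg n) K)
    (by positivity)

lemma tendsto_rpowTaylor {w : ℝ} (hw : 0 < w) (n : ℕ) :
    Tendsto (rpowTaylor w · n) atTop (𝓝 ((n : ℝ) ^ (-w))) := by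
  rw [← rpow_neg_add_one_mul_exp_log hw, Real.exp_eq_exp_ℝ]
  exact ((NormedSpace.expSeries_div_hasSum_exp (Real.log n)).tendsto_sum_nat).const_mul _

lemma logMul_iterate_apply (f : ℕ → ℂ) (k n : ℕ) :
    LSeries.logMul^[k] f n = Complex.log n ^ k * f n := by
  induction k with
  | zero => simp
  | succ k ih => rw [Function.iterate_succ_apply', LSeries.logMul, ih]; ring

lemma abscissaOfAbsConv_exp_le (x : ℝ) :
    LSeries.abscissaOfAbsConv (fun n ↦ cexp (2 * π * I * x * n)) ≤ 1 := by
  refine LSeries.abscissaOfAbsConv_le_of_le_const ⟨1, fun n _ ↦ ?_⟩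
  rw [show 2 * π * I * x * n = ((2 * π * x * n : ℝ) : ℂ) * I by push_cast; ring,
    Complex.norm_exp_ofReal_mul_I]

lemma abscissaOfAbsConv_exp_lt {w : ℝ} (hw : 0 < w) (x : ℝ) :
    LSeries.abscissaOfAbsConv (fun n ↦ cexp (2 * π * I * x * n)) < ((w + 1 : ℂ).re : EReal) := by
  refine (abscissaOfAbsConv_exp_le x).trans_lt ?_
  simpa using (by exact_mod_cast (by linarith : 1 < w + 1) : ((1 : ℝ) : EReal) < ((w + 1 : ℝ)))

lemma hasSum_rpowTaylor_mul_fourier {w : ℝ} (hw : 0 < w) (K : ℕ) (x : ℝ) :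
    HasSum (fun n : ℕ ↦ (rpowTaylor w K n : ℂ) * fourier (n : ℤ) (x : UnitAddCircle))
      (∑ k ∈ Finset.range K, (k.factorial : ℂ)⁻¹ *
        LSeries (LSeries.logMul^[k] fun n ↦ cexp (2 * π * I * x * n)) (w + 1)) := by
  have h (k : ℕ) := ((LSeriesSummable_of_abscissaOfAbsConv_lt_re
    (LSeries.absicssaOfAbsConv_logPowMul.trans_lt (abscissaOfAbsConv_exp_lt hw x) :
    LSeries.abscissaOfAbsConv (LSeries.logMul^[k] fun n ↦ cexp (2 * π * I * x * n)) < _)).hasSum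
    ).mul_left (k.factorial : ℂ)⁻¹
  refine (hasSum_sum fun k _ ↦ h k).congr_fun fun n ↦ ?_
  rcases n.eq_zero_or_pos with rfl | hn
  · simp [rpowTaylor, Real.zero_rpow (by linarith : -1 + -w ≠ 0)]
  · have hn' : (0 : ℝ) ≤ n := by positivity
    simp_rw [LSeries.term_of_ne_zero hn.ne', logMul_iterate_apply, fourier_coe_apply]
    rw [rpowTaylor, ofReal_mul, ofReal_cpow hn', ofReal_sum, Finset.mul_sum, Finset.sum_mul]
    refine Finset.sum_congr rfl fun k _ ↦ ?_
    push_cast [ofReal_log]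
    rw [Complex.cpow_neg, show 2 * π * I * n * x / 1 = 2 * π * I * x * n by ring]
    ring

lemma summable_rpowTaylor {w : ℝ} (hw : 0 < w) (K : ℕ) : Summable (rpowTaylor w K) := by
  have := (hasSum_rpowTaylor_mul_fourier hw K 0).summable
  simp only [QuotientAddGroup.mk_zero, fourier_eval_zero, mul_one] at this
  exact_mod_cast this

/-- The Taylor expansion of `expZeta x` at `w + 1`, evaluated at `w` and written as a limit of
absolutely convergent Fourier series in `x`. -/
lemma tendsto_tsum_rpowTaylor_mul_fourier {w : ℝ} (hw : 0 < w) {x : UnitAddCircle} (hx : x ≠ 0) :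
    Tendsto (fun K ↦ ∑' n : ℕ, (rpowTaylor w K n : ℂ) * fourier (n : ℤ) x) atTop
      (𝓝 (expZeta x w)) := by
  induction x using QuotientAddGroup.induction_on with | H x =>
  simp_rw [(hasSum_rpowTaylor_mul_fourier hw _ x).tsum_eq]
  have h := (Complex.hasSum_taylorSeries_of_entire (differentiable_expZeta_of_ne_zero hx)
    (w + 1) w).tendsto_sum_nat
  refine h.congr fun K ↦ Finset.sum_congr rfl fun k _ ↦ ?_
  have heq : expZeta (x : UnitAddCircle) =ᶠ[𝓝 (w + 1 : ℂ)]
      LSeries fun n ↦ cexp (2 * π * I * x * n) := by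
    have : {s : ℂ | 1 < s.re} ∈ 𝓝 (w + 1 : ℂ) :=
      (isOpen_lt continuous_const continuous_re).mem_nhds (by simpa using hw)
    filter_upwards [this] with s hs using (LSeriesHasSum_exp x hs).LSeries_eq.symm
  rw [heq.iteratedDeriv_eq, LSeries_iteratedDeriv k (abscissaOfAbsConv_exp_lt hw x)]
  simp only [smul_eq_mul, sub_add_cancel_left, ← mul_assoc, ← mul_pow]
  simp

theorem integral_norm_sq_expZeta_add_expZeta_neg {w : ℝ} (hw : 1 / 2 < w) {A B : ℂ}
    (hA : ‖A‖ = 1) (hB : ‖B‖ = 1) :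
    ∫ x : UnitAddCircle, ‖A * expZeta x w + B * expZeta (-x) w‖ ^ 2 ∂haarAddCircle =
      ∑' n : ℤ, |(n : ℝ)| ^ (-2 * w) := by
  have hw0 : 0 < w := by linarith
  let p (n : ℤ) : ℂ := if 0 ≤ n then A else B
  have hp (n : ℤ) : ‖p n‖ = 1 := by unfold p; split_ifs <;> assumption
  let c (n : ℤ) : ℂ := p n * (((n.natAbs : ℝ) ^ (-w) : ℝ) : ℂ)
  let b (K : ℕ) (n : ℤ) : ℂ := p n * (rpowTaylor w K n.natAbs : ℂ)
  have hcn (n : ℤ) : ‖c n‖ = (n.natAbs : ℝ) ^ (-w) := by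
    simp [c, hp, abs_of_nonneg (Real.rpow_nonneg (abs_nonneg (n : ℝ)) _)]
  have hbn (K : ℕ) (n : ℤ) : ‖b K n‖ = rpowTaylor w K n.natAbs := by
    simp [b, hp, abs_of_nonneg (rpowTaylor_nonneg ..)]
  have hc2 (n : ℤ) : ‖c n‖ ^ 2 = |(n : ℝ)| ^ (-2 * w) := by
    rw [hcn, ← Real.rpow_mul_natCast (by positivity), Nat.cast_natAbs, Int.cast_abs]
    congr 1; push_cast; ring
  simp_rw [← hc2]
  refine integral_norm_sq_eq_tsum_of_tendsto (b := b) ?_ (fun K ↦ ?_) (fun K n ↦ ?_)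
    (fun n ↦ ?_) ?_
  · simp_rw [hc2]
    exact (Real.summable_abs_int_rpow (b := 2 * w) (by linarith)).congr fun n ↦ by ring_nf
  · refine .of_norm ?_
    simp_rw [hbn]
    exact .of_nat_of_neg (by simpa using summable_rpowTaylor hw0 K)
      (by simpa using summable_rpowTaylor hw0 K)
  · rw [hbn, hcn]
    exact rpowTaylor_le hw0 ..
  · exact ((continuous_ofReal.tendsto _).comp (tendsto_rpowTaylor hw0 _)).const_mul _
  · filter_upwards [ae_haarAddCircle_ne_zero] with x hx
    refine (((tendsto_tsum_rpowTaylor_mul_fourier hw0 hx).const_mul A).add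
      ((tendsto_tsum_rpowTaylor_mul_fourier hw0 (neg_ne_zero.mpr hx)).const_mul B)).congr fun K ↦ ?_
    have hs (y : UnitAddCircle) :
        Summable fun n : ℕ ↦ (rpowTaylor w K n : ℂ) * fourier (n : ℤ) y := by
      induction y using QuotientAddGroup.induction_on with
      | H y => exact (hasSum_rpowTaylor_mul_fourier hw0 K y).summable
    have hz : rpowTaylor w K 0 = 0 := by
      simp [rpowTaylor, Real.zero_rpow (by linarith : -1 + -w ≠ 0)]
    have := HasSum.of_nat_of_neg (f := fun n ↦ b K n * fourier n x)
      (((hs x).hasSum.mul_left A).congr_fun fun n ↦ by simp [b, p, mul_assoc])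
      (((hs (-x)).hasSum.mul_left B).congr_fun fun n ↦ by
        rcases n.eq_zero_or_pos with rfl | hn
        · simp [b, hz]
        · simp [b, p, mul_assoc, hn.ne'])
    simpa [b, hz] using this.tsum_eq.symm

theorem parseval_hurwitzZeta (σ : ℝ) (hσ : σ < 1/2) :
    (∫ α in (0:ℝ)..1, ‖hurwitzZeta (α : UnitAddCircle) (σ : ℂ)‖ ^ 2
        = ‖Complex.Gamma (1 - (σ : ℂ))‖ ^ 2 *
            ∑' n : {n : ℤ // n ≠ 0}, ‖(2 * π * I * (n.1 : ℂ)) ^ ((σ : ℂ) - 1)‖ ^ 2)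
    ∧ ((∫ α in (0:ℝ)..1, ‖hurwitzZeta (α : UnitAddCircle) (σ : ℂ)‖ ^ 2 : ℝ) : ℂ)
        = (((2 : ℝ) ^ (2 * σ - 1) * π ^ (2 * σ - 2) *
            ‖Complex.Gamma (1 - (σ : ℂ))‖ ^ 2 : ℝ) : ℂ) * riemannZeta (2 - 2 * (σ : ℂ)) := by
  have hw : 1 / 2 < 1 - σ := by linarith
  have hint : ∫ α in (0:ℝ)..1, ‖hurwitzZeta (α : UnitAddCircle) (σ : ℂ)‖ ^ 2 =
      ((2 * π) ^ (2 * σ - 2) * ‖Complex.Gamma (1 - (σ : ℂ))‖ ^ 2) *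
        ∑' n : ℤ, |(n : ℝ)| ^ (2 * σ - 2) := by
    have h := UnitAddCircle.intervalIntegral_preimage 0
      (fun x : UnitAddCircle ↦ ‖hurwitzZeta x (σ : ℂ)‖ ^ 2)
    rw [zero_add] at h
    rw [h, show (volume : Measure UnitAddCircle) = haarAddCircle by
      simp [volume_eq_smul_haarAddCircle]]
    have hA : ‖cexp (-π * I * (1 - σ : ℝ) / 2)‖ = 1 := by
      rw [show -π * I * (1 - σ : ℝ) / 2 = ((-π * (1 - σ) / 2 : ℝ) : ℂ) * I by push_cast; ring,
        Complex.norm_exp_ofReal_mul_I]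
    have hB : ‖cexp (π * I * (1 - σ : ℝ) / 2)‖ = 1 := by
      rw [show π * I * (1 - σ : ℝ) / 2 = ((π * (1 - σ) / 2 : ℝ) : ℂ) * I by push_cast; ring,
        Complex.norm_exp_ofReal_mul_I]
    have hP := integral_norm_sq_expZeta_add_expZeta_neg hw hA hB
    rw [show -2 * (1 - σ) = 2 * σ - 2 by ring] at hP
    rw [← hP, ← integral_const_mul]
    refine integral_congr_ae ?_
    filter_upwards [ae_haarAddCircle_ne_zero] with x hx
    have hs (n : ℕ) : ((1 - σ : ℝ) : ℂ) ≠ -n := by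
      norm_cast
      push_cast
      have : (0 : ℝ) ≤ n := by positivity
      linarith
    have hf := hurwitzZeta_one_sub x hs (.inl hx)
    rw [show (1 : ℂ) - (1 - σ : ℝ) = σ by push_cast; ring] at hf
    have hpi : ‖(2 * π : ℂ) ^ (-((1 - σ : ℝ) : ℂ))‖ = (2 * π) ^ (σ - 1) := by
      rw [← ofReal_neg, norm_cpow_real, show ‖(2 * π : ℂ)‖ = 2 * π by simp [pi_nonneg]]
      ring_nf
    rw [hf, norm_mul, norm_mul, hpi, mul_pow, mul_pow, ← Real.rpow_mul_natCast (by positivity)]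
    push_cast
    ring_nf
  have hsub : ∑' n : {n : ℤ // n ≠ 0}, ‖(2 * π * I * (n.1 : ℂ)) ^ ((σ : ℂ) - 1)‖ ^ 2 =
      (2 * π) ^ (2 * σ - 2) * ∑' n : ℤ, |(n : ℝ)| ^ (2 * σ - 2) := by
    have hterm (n : ℤ) : ‖(2 * π * I * (n : ℂ)) ^ ((σ : ℂ) - 1)‖ ^ 2 =
        (2 * π) ^ (2 * σ - 2) * |(n : ℝ)| ^ (2 * σ - 2) := by
      rw [show (σ : ℂ) - 1 = (σ - 1 : ℝ) by push_cast; rfl, norm_cpow_real,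
        ← Real.rpow_mul_natCast (by positivity),
        show ‖2 * π * I * (n : ℂ)‖ = (2 * π) * |(n : ℝ)| by simp [pi_nonneg],
        Real.mul_rpow (by positivity) (by positivity)]
      push_cast
      ring_nf
    simp_rw [hterm]
    rw [tsum_mul_left]
    congr 1
    refine tsum_subtype_eq_of_support_subset (s := {n : ℤ | n ≠ 0})
      (f := fun n : ℤ ↦ |(n : ℝ)| ^ (2 * σ - 2)) ?_
    rintro n hn rfl
    exact hn (by simp [Real.zero_rpow (by linarith : 2 * σ - 2 ≠ 0)])
  have hzeta : ((∑' n : ℤ, |(n : ℝ)| ^ (2 * σ - 2) : ℝ) : ℂ) =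
      2 * riemannZeta (2 - 2 * (σ : ℂ)) := by
    have hs : Summable fun n : ℕ ↦ (n : ℝ) ^ (2 * σ - 2) :=
      Real.summable_nat_rpow.mpr (by linarith)
    have hz := HasSum.of_nat_of_neg (f := fun n : ℤ ↦ |(n : ℝ)| ^ (2 * σ - 2))
      (by simpa using hs.hasSum) (by simpa using hs.hasSum)
    rw [hz.tsum_eq, zeta_eq_tsum_one_div_nat_cpow (by simp; linarith), Int.cast_zero, abs_zero,
      Real.zero_rpow (by linarith), sub_zero, ← two_mul, ofReal_mul, ofReal_tsum, ofReal_ofNat]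
    congr 2 with n
    rw [ofReal_cpow (by positivity), one_div, ← Complex.cpow_neg]
    push_cast
    ring_nf
  refine ⟨by rw [hint, hsub]; ring, ?_⟩
  rw [hint, ofReal_mul, hzeta, Real.mul_rpow (by positivity) (by positivity),
    show 2 * σ - 1 = (2 * σ - 2) + 1 by ring, Real.rpow_add_one (by norm_num)]
  push_cast
  ring
end

section
/- For a nonzero integer n, the n-th Fourier coefficient of α ↦ log(Γ(α)/√(2π)) on [0,1] is given by ∫₀¹ log(Γ(α)/√(2π)) e^{-2πinα} dα = (2πin)^{-1}(Log(2πin) + γ), with the principal logarithm, and ∫₀¹ log(Γ(α)/√(2π)) dα = 0. -/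
open Complex Real

open Filter Topology MeasureTheory Set

lemma IntervalIntegrable.complex_ofReal {f : ℝ → ℝ} {μ : Measure ℝ} {a b : ℝ}
    (h : IntervalIntegrable f μ a b) : IntervalIntegrable (fun x => (f x : ℂ)) μ a b :=
  ⟨h.1.ofReal, h.2.ofReal⟩

/-- The entire function `(1 - exp (-z)) / z`, with value `1` at `0`. -/
noncomputable def einIntegrand (z : ℂ) : ℂ := dslope (fun w : ℂ => 1 - Complex.exp (-w)) 0 z

lemma mul_einIntegrand (z : ℂ) : z * einIntegrand z = 1 - Complex.exp (-z) := by
  simpa [einIntegrand] using sub_smul_dslope (fun w : ℂ => 1 - Complex.exp (-w)) 0 z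

lemma differentiable_einIntegrand : Differentiable ℂ einIntegrand := by
  rw [← differentiableOn_univ]
  refine (Complex.differentiableOn_dslope univ_mem).2 ?_
  fun_prop

lemma exists_primitive_einIntegrand :
    ∃ G : ℂ → ℂ, G 0 = 0 ∧ ∀ z, HasDerivAt G (einIntegrand z) z := by
  obtain ⟨G, hG, h⟩ := differentiable_einIntegrand.isExactOn_univ.with_val_at 0 0
  exact ⟨G, hG, fun z => h z (mem_univ z)⟩

/-- The complementary exponential integral, the primitive of `(1 - exp (-z)) / z`
vanishing at `0`. -/
noncomputable def complexEin : ℂ → ℂ := Classical.choose exists_primitive_einIntegrand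

lemma complexEin_zero : complexEin 0 = 0 := (Classical.choose_spec exists_primitive_einIntegrand).1

lemma hasDerivAt_complexEin (z : ℂ) : HasDerivAt complexEin (einIntegrand z) z :=
  (Classical.choose_spec exists_primitive_einIntegrand).2 z

lemma continuous_complexEin : Continuous complexEin :=
  continuous_iff_continuousAt.2 fun z => (hasDerivAt_complexEin z).continuousAt

lemma intervalIntegrable_log_mul_cexp (c : ℂ) (a b : ℝ) :
    IntervalIntegrable (fun x : ℝ => (Real.log x : ℂ) * Complex.exp (-(c * x))) volume a b := by
  have h : IntervalIntegrable (fun x : ℝ => (Real.log x : ℂ)) volume a b :=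
    intervalIntegral.intervalIntegrable_log'.complex_ofReal
  exact h.mul_continuousOn (by fun_prop)

lemma integral_log_mul_cexp {c : ℂ} (hc : c ≠ 0) {M : ℝ} (hM : 0 ≤ M) :
    ∫ x in (0:ℝ)..M, (Real.log x : ℂ) * Complex.exp (-(c * x)) =
      c⁻¹ * (Real.log M * (1 - Complex.exp (-(c * M))) - complexEin (c * M)) := by
  have key := intervalIntegral.integral_eq_sub_of_hasDerivAt_of_le
    (f := fun x : ℝ => ((x * Real.log x : ℝ) : ℂ) * einIntegrand (c * x)
      - c⁻¹ * complexEin (c * x)) hM ?_ ?_ (intervalIntegrable_log_mul_cexp c 0 M)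
  · rw [key, ← mul_einIntegrand]
    simp only [complexEin_zero, ofReal_zero, mul_zero, zero_mul, sub_zero, ofReal_mul]
    field_simp
  · refine Continuous.continuousOn (Continuous.sub (Continuous.mul ?_ ?_) (Continuous.mul ?_ ?_))
    · exact continuous_ofReal.comp Real.continuous_mul_log
    · exact differentiable_einIntegrand.continuous.comp (by fun_prop)
    · fun_prop
    · exact continuous_complexEin.comp (by fun_prop)
  · intro x hx
    have hx0 : x ≠ 0 := hx.1.ne'
    have hx0' : (x : ℂ) ≠ 0 := mod_cast hx0
    have hcx : HasDerivAt (fun y : ℝ => c * (y : ℂ)) c x := by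
      simpa using (hasDerivAt_id x).ofReal_comp.const_mul c
    have h1 : HasDerivAt (fun y : ℝ => (Real.log y : ℂ)) ((x⁻¹ : ℝ) : ℂ) x :=
      (Real.hasDerivAt_log hx0).ofReal_comp
    have h2 : HasDerivAt (fun y : ℝ => c⁻¹ * (1 - Complex.exp (-(c * y))))
        (Complex.exp (-(c * x))) x := by
      convert! ((hcx.neg.cexp).const_sub 1).const_mul c⁻¹ using 1
      simp only [Pi.neg_apply]
      field_simp
    have h3 : HasDerivAt (fun y : ℝ => c⁻¹ * complexEin (c * y)) (einIntegrand (c * x)) x := by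
      convert! ((hasDerivAt_complexEin (c * x)).comp x hcx).const_mul c⁻¹ using 1
      field_simp
    convert! (h1.mul h2).sub h3 using 1
    · ext y
      simp only [Pi.sub_apply, Pi.mul_apply, ← mul_einIntegrand]
      push_cast
      field_simp
    · rw [← mul_einIntegrand]
      push_cast
      field_simp
      ring

lemma integral_log_mul_exp_neg_Ioi :
    ∫ t in Ioi (0:ℝ), (Real.log t : ℂ) * Complex.exp (-(1 * t)) =
      -(Real.eulerMascheroniConstant : ℂ) := by
  have h := Complex.hasDerivAt_GammaIntegral (s := 1) (by simp)
  have h' : HasDerivAt Complex.Gamma _ 1 := h.congr_of_eventuallyEq <| by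
    have : ∀ᶠ s : ℂ in 𝓝 1, 0 < s.re :=
      Complex.continuous_re.continuousAt.eventually (lt_mem_nhds (by simp))
    filter_upwards [this] with s hs using Complex.Gamma_eq_integral hs
  rw [← h'.unique Complex.hasDerivAt_Gamma_one]
  refine setIntegral_congr_fun measurableSet_Ioi fun t ht => ?_
  simp

lemma integrableOn_log_mul_exp_neg_Ioi :
    IntegrableOn (fun t : ℝ => (Real.log t : ℂ) * Complex.exp (-(1 * t))) (Ioi 0) := by
  by_contra h
  have h0 := integral_log_mul_exp_neg_Ioi
  rw [integral_undef h, eq_comm, neg_eq_zero, ofReal_eq_zero] at h0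
  linarith [Real.one_half_lt_eulerMascheroniConstant]

lemma tendsto_complexEin_ofReal_sub_log :
    Tendsto (fun R : ℝ => complexEin R - Real.log R) atTop
      (𝓝 (Real.eulerMascheroniConstant : ℂ)) := by
  have h1 := (intervalIntegral_tendsto_integral_Ioi 0 integrableOn_log_mul_exp_neg_Ioi
    tendsto_id).neg
  rw [integral_log_mul_exp_neg_Ioi, neg_neg] at h1
  have h2 : Tendsto (fun R : ℝ => ((Real.log R * Real.exp (-R) : ℝ) : ℂ)) atTop (𝓝 0) := by
    rw [← ofReal_zero]
    refine (continuous_ofReal.tendsto 0).comp ?_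
    refine squeeze_zero' (g := fun R : ℝ => R ^ 1 * Real.exp (-R)) ?_ ?_
      (Real.tendsto_pow_mul_exp_neg_atTop_nhds_zero 1)
    · filter_upwards [eventually_ge_atTop 1] with R hR
      have := Real.log_nonneg hR
      positivity
    · filter_upwards [eventually_ge_atTop 1] with R hR
      rw [pow_one]
      gcongr
      exact Real.log_le_self (by linarith)
  have h3 := h1.sub h2
  rw [sub_zero] at h3
  refine h3.congr' ?_
  filter_upwards [eventually_ge_atTop 0] with R hR
  rw [id, integral_log_mul_cexp one_ne_zero hR]
  push_cast
  ring_nf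

lemma complexEin_mul_exp_sub (R φ : ℝ) :
    complexEin (R * Complex.exp (φ * I)) - complexEin R =
      I * (φ - ∫ θ in (0:ℝ)..φ, Complex.exp (-(R * Complex.exp (θ * I)))) := by
  have hd : ∀ θ : ℝ, HasDerivAt (fun θ : ℝ => complexEin (R * Complex.exp (θ * I)))
      (I * (1 - Complex.exp (-(R * Complex.exp (θ * I))))) θ := by
    intro θ
    have h1 : HasDerivAt (fun θ : ℝ => (R : ℂ) * Complex.exp (θ * I))
        (R * (Complex.exp (θ * I) * I)) θ := by
      simpa using (((hasDerivAt_id θ).ofReal_comp.mul_const I).cexp).const_mul (R : ℂ)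
    convert! (hasDerivAt_complexEin _).comp θ h1 using 1
    rw [← mul_einIntegrand]
    ring
  have key := intervalIntegral.integral_eq_sub_of_hasDerivAt (a := 0) (b := φ)
    (fun θ _ => hd θ) (Continuous.intervalIntegrable (by fun_prop) _ _)
  have hi : IntervalIntegrable (fun θ : ℝ => Complex.exp (-(R * Complex.exp (θ * I))))
    volume 0 φ := Continuous.intervalIntegrable (by fun_prop) _ _
  rw [intervalIntegral.integral_const_mul,
    intervalIntegral.integral_sub intervalIntegrable_const hi] at key
  simpa using key.symm

lemma tendsto_integral_cexp_neg_arc {φ : ℝ} (hφ : |φ| ≤ π / 2) :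
    Tendsto (fun R : ℝ => ∫ θ in (0:ℝ)..φ, Complex.exp (-(R * Complex.exp (θ * I)))) atTop
      (𝓝 0) := by
  have hnorm : ∀ R θ : ℝ, ‖Complex.exp (-(R * Complex.exp (θ * I)))‖
      = Real.exp (-(R * Real.cos θ)) := by
    intro R θ
    rw [Complex.norm_exp]
    simp [Complex.exp_ofReal_mul_I_re]
  have hmem : ∀ θ ∈ uIoc 0 φ, -(π / 2) ≤ θ ∧ θ ≤ π / 2 := by
    intro θ hθ
    have := abs_le.1 hφ
    have := pi_pos
    rcases mem_uIoc.1 hθ with h | h <;> constructor <;> linarith [h.1, h.2]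
  have h := intervalIntegral.tendsto_integral_filter_of_dominated_convergence
    (F := fun (R θ : ℝ) => Complex.exp (-(R * Complex.exp (θ * I)))) (f := fun _ => 0)
    (μ := volume) (a := 0) (b := φ) (l := atTop) (fun _ => 1) ?_ ?_ intervalIntegrable_const ?_
  · simpa using h
  · exact .of_forall fun R => Continuous.aestronglyMeasurable (by fun_prop)
  · filter_upwards [eventually_ge_atTop 0] with R hR
    refine .of_forall fun θ hθ => ?_
    rw [hnorm, Real.exp_le_one_iff, neg_nonpos]
    exact mul_nonneg hR (Real.cos_nonneg_of_mem_Icc (hmem θ hθ))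
  · have h1 : ∀ᵐ θ : ℝ, θ ≠ π / 2 := by simp [ae_iff]
    have h2 : ∀ᵐ θ : ℝ, θ ≠ -(π / 2) := by simp [ae_iff]
    filter_upwards [h1, h2] with θ h1 h2 hθ
    rw [tendsto_zero_iff_norm_tendsto_zero]
    simp only [hnorm]
    have hcos : 0 < Real.cos θ := Real.cos_pos_of_mem_Ioo
      ⟨lt_of_le_of_ne (hmem θ hθ).1 h2.symm, lt_of_le_of_ne (hmem θ hθ).2 h1⟩
    exact Real.tendsto_exp_neg_atTop_nhds_zero.comp (tendsto_id.atTop_mul_const hcos)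

lemma tendsto_complexEin_mul_sub_log {z : ℂ} (hz : z ≠ 0) (hre : 0 ≤ z.re) :
    Tendsto (fun M : ℝ => complexEin (z * M) - Real.log M) atTop
      (𝓝 (Complex.log z + Real.eulerMascheroniConstant)) := by
  have hpos : 0 < ‖z‖ := norm_pos_iff.2 hz
  have hM : Tendsto (fun M : ℝ => ‖z‖ * M) atTop atTop := tendsto_id.const_mul_atTop hpos
  have h1 := tendsto_complexEin_ofReal_sub_log.comp hM
  have h2 := (tendsto_integral_cexp_neg_arc (abs_arg_le_pi_div_two_iff.2 hre)).comp hM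
  have h3 := (h1.add ((h2.const_sub (z.arg : ℂ)).const_mul I)).add_const (Real.log ‖z‖ : ℂ)
  convert! h3.congr' ?_ using 2
  · rw [Complex.log]
    ring
  · filter_upwards [eventually_gt_atTop 0] with M hM
    simp only [Function.comp_apply]
    rw [← complexEin_mul_exp_sub, Real.log_mul hpos.ne' hM.ne']
    have : ((‖z‖ * M : ℝ) : ℂ) * Complex.exp (z.arg * I) = z * M := by
      conv_rhs => rw [← Complex.norm_mul_exp_arg_mul_I z]
      push_cast
      ring
    rw [this]
    push_cast
    ring

lemma abs_logGammaSeq_sub_log_Gamma_le {x : ℝ} (hx : 0 < x) (hx1 : x ≤ 1) {n : ℕ} (hn : n ≠ 0) :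
    |BohrMollerup.logGammaSeq x n - Real.log (Real.Gamma x)| ≤ Real.log (n + 1) - Real.log n := by
  have hfeq : ∀ {y : ℝ}, 0 < y → (Real.log ∘ Real.Gamma) (y + 1)
      = (Real.log ∘ Real.Gamma) y + Real.log y := fun {y} hy => by
    rw [Function.comp_apply, Real.Gamma_add_one hy.ne',
      Real.log_mul hy.ne' (Real.Gamma_pos_of_pos hy).ne', add_comm, Function.comp_apply]
  have h1 := BohrMollerup.le_logGammaSeq Real.convexOn_log_Gamma hfeq hx hx1 n
  have h2 := BohrMollerup.ge_logGammaSeq Real.convexOn_log_Gamma hfeq hx hn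
  simp only [Function.comp_apply, Real.Gamma_one, Real.log_one, zero_add] at h1 h2
  have h3 : 0 ≤ Real.log (n + 1) - Real.log n :=
    sub_nonneg.2 (Real.log_le_log (by positivity) (by linarith))
  rw [abs_le]
  constructor <;> nlinarith

lemma intervalIntegrable_log_Gamma :
    IntervalIntegrable (fun x => Real.log (Real.Gamma x)) volume 0 1 := by
  have h1 : IntervalIntegrable (fun x => Real.log (Real.Gamma (x + 1)) - Real.log x)
      volume 0 1 := by
    refine IntervalIntegrable.sub (ContinuousOn.intervalIntegrable fun x hx => ?_)
      intervalIntegral.intervalIntegrable_log'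
    rw [uIcc_of_le zero_le_one] at hx
    have hx' : 0 < x + 1 := by linarith [hx.1]
    have hG : ContinuousAt Real.Gamma (x + 1) :=
      (Real.differentiableAt_Gamma fun m => by
        have : (0:ℝ) ≤ m := m.cast_nonneg
        linarith).continuousAt
    exact (ContinuousAt.log (ContinuousAt.comp (f := fun y : ℝ => y + 1) hG (by fun_prop))
      (Real.Gamma_pos_of_pos hx').ne').continuousWithinAt
  refine h1.congr fun x hx => ?_
  rw [uIoc_of_le zero_le_one] at hx
  rw [Real.Gamma_add_one hx.1.ne', Real.log_mul hx.1.ne' (Real.Gamma_pos_of_pos hx.1).ne']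
  ring

lemma integral_log_Gamma : ∫ x in (0:ℝ)..1, Real.log (Real.Gamma x) = Real.log (2 * π) / 2 := by
  have h1 : ∫ x in (0:ℝ)..1, Real.log (Real.Gamma (1 - x))
      = ∫ x in (0:ℝ)..1, Real.log (Real.Gamma x) := by
    simpa using intervalIntegral.integral_comp_sub_left (a := 0) (b := 1)
      (fun x => Real.log (Real.Gamma x)) 1
  have hint : IntervalIntegrable (fun x => Real.log (Real.Gamma (1 - x))) volume 0 1 := by
    simpa using (intervalIntegrable_log_Gamma.comp_sub_left 1).symm
  have hsin : IntervalIntegrable (fun x => Real.log (Real.sin (π * x))) volume 0 1 := by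
    have : IntervalIntegrable (Real.log ∘ Real.sin) volume 0 π := intervalIntegrable_log_sin
    simpa [pi_ne_zero] using this.comp_mul_left (c := π)
  have h2 : ∫ x in (0:ℝ)..1, (Real.log (Real.Gamma x) + Real.log (Real.Gamma (1 - x)))
      = ∫ x in (0:ℝ)..1, (Real.log π - Real.log (Real.sin (π * x))) := by
    refine intervalIntegral.integral_congr_Ioo_of_le zero_le_one fun x hx => ?_
    have hs : 0 < Real.sin (π * x) := Real.sin_pos_of_pos_of_lt_pi
      (mul_pos pi_pos hx.1) (by nlinarith [hx.2, pi_pos])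
    rw [← Real.log_mul (Real.Gamma_pos_of_pos hx.1).ne'
      (Real.Gamma_pos_of_pos (sub_pos.2 hx.2)).ne', Real.Gamma_mul_Gamma_one_sub,
      Real.log_div pi_ne_zero hs.ne']
  have h3 : ∫ x in (0:ℝ)..1, Real.log (Real.sin (π * x)) = -Real.log 2 := by
    rw [intervalIntegral.integral_comp_mul_left (fun x => Real.log (Real.sin x)) pi_ne_zero]
    simp only [mul_zero, mul_one, integral_log_sin_zero_pi, smul_eq_mul]
    field_simp
  rw [intervalIntegral.integral_add intervalIntegrable_log_Gamma hint, h1,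
    intervalIntegral.integral_sub intervalIntegrable_const hsin, h3] at h2
  rw [Real.log_mul two_ne_zero pi_ne_zero]
  simp at h2
  linarith

section FourierCoefficients

variable {c : ℂ}

lemma integral_cexp_neg_mul_of_exp_eq_one (hc : c ≠ 0) (h1 : Complex.exp (-c) = 1) :
    ∫ x in (0:ℝ)..1, Complex.exp (-(c * x)) = 0 := by
  simp_rw [← neg_mul]
  rw [integral_exp_mul_complex (neg_ne_zero.2 hc)]
  simp [h1]

lemma integral_mul_cexp_neg_mul_of_exp_eq_one (hc : c ≠ 0) (h1 : Complex.exp (-c) = 1) :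
    ∫ x in (0:ℝ)..1, (x : ℂ) * Complex.exp (-(c * x)) = -c⁻¹ := by
  have hcx : ∀ x : ℝ, HasDerivAt (fun y : ℝ => c * (y : ℂ)) c x := fun x => by
    simpa using (hasDerivAt_id x).ofReal_comp.const_mul c
  have hd : ∀ x : ℝ, HasDerivAt
      (fun x : ℝ => -c⁻¹ * ((x : ℂ) * Complex.exp (-(c * x))) - c⁻¹ ^ 2 * Complex.exp (-(c * x)))
      ((x : ℂ) * Complex.exp (-(c * x))) x := fun x => by
    have he := (hcx x).neg.cexp
    convert! (((hasDerivAt_id x).ofReal_comp.mul he).const_mul (-c⁻¹)).sub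
      (he.const_mul (c⁻¹ ^ 2)) using 1
    simp only [id, ofReal_one, Pi.neg_apply]
    field_simp
    ring
  rw [intervalIntegral.integral_eq_sub_of_hasDerivAt (fun x _ => hd x)
    (Continuous.intervalIntegrable (by fun_prop) _ _)]
  simp [h1]

lemma integral_log_add_nat_mul_cexp (h1 : Complex.exp (-c) = 1) (m : ℕ) :
    ∫ x in (0:ℝ)..1, (Real.log (x + m) : ℂ) * Complex.exp (-(c * x)) =
      ∫ x in (m:ℝ)..(m + 1 : ℕ), (Real.log x : ℂ) * Complex.exp (-(c * x)) := by
  have hm : Complex.exp (-(c * m)) = 1 := by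
    rw [← neg_mul, mul_comm, Complex.exp_nat_mul, h1, one_pow]
  have h := intervalIntegral.integral_comp_add_right (a := 0) (b := 1)
    (fun x : ℝ => (Real.log x : ℂ) * Complex.exp (-(c * x))) (m : ℝ)
  rw [zero_add, add_comm (1 : ℝ)] at h
  rw [Nat.cast_succ, ← h]
  congr 1
  ext x
  push_cast
  rw [mul_add, neg_add, Complex.exp_add, hm, mul_one]

lemma intervalIntegrable_log_add_nat (m : ℕ) :
    IntervalIntegrable (fun x : ℝ => (Real.log (x + m) : ℂ)) volume 0 1 := by
  have h : IntervalIntegrable (fun x : ℝ => (Real.log x : ℂ)) volume m (m + 1) :=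
    intervalIntegral.intervalIntegrable_log'.complex_ofReal
  simpa using h.comp_add_right (m : ℝ)

lemma integral_logGammaSeq_mul_cexp (hc : c ≠ 0) (h1 : Complex.exp (-c) = 1) (n : ℕ) :
    ∫ x in (0:ℝ)..1, (BohrMollerup.logGammaSeq x n : ℂ) * Complex.exp (-(c * x)) =
      c⁻¹ * (complexEin (c * (n + 1 : ℕ)) - Real.log n) := by
  have hexp : Continuous fun x : ℝ => Complex.exp (-(c * x)) := by fun_prop
  have hlog : ∀ m : ℕ, IntervalIntegrable
      (fun x : ℝ => (Real.log (x + m) : ℂ) * Complex.exp (-(c * x))) volume 0 1 :=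
    fun m => (intervalIntegrable_log_add_nat m).mul_continuousOn hexp.continuousOn
  have hn : Complex.exp (-(c * (n + 1 : ℕ))) = 1 := by
    rw [← neg_mul, mul_comm, Complex.exp_nat_mul, h1, one_pow]
  have hsum : ∑ m ∈ Finset.range (n + 1),
      ∫ x in (0:ℝ)..1, (Real.log (x + m) : ℂ) * Complex.exp (-(c * x)) =
        -c⁻¹ * complexEin (c * (n + 1 : ℕ)) := by
    simp_rw [integral_log_add_nat_mul_cexp h1]
    rw [intervalIntegral.sum_integral_adjacent_intervals (a := fun m : ℕ => (m : ℝ))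
      (fun k _ => intervalIntegrable_log_mul_cexp c _ _), Nat.cast_zero,
      integral_log_mul_cexp hc (Nat.cast_nonneg _), ofReal_natCast, hn]
    ring
  have hsplit : ∀ x : ℝ, (BohrMollerup.logGammaSeq x n : ℂ) * Complex.exp (-(c * x)) =
      Real.log n * ((x : ℂ) * Complex.exp (-(c * x)))
        + Real.log n.factorial * Complex.exp (-(c * x))
        - ∑ m ∈ Finset.range (n + 1), (Real.log (x + m) : ℂ) * Complex.exp (-(c * x)) := by
    intro x
    rw [BohrMollerup.logGammaSeq, ← Finset.sum_mul]
    push_cast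
    ring
  simp_rw [hsplit]
  rw [intervalIntegral.integral_sub, intervalIntegral.integral_add,
    intervalIntegral.integral_const_mul, intervalIntegral.integral_const_mul,
    integral_cexp_neg_mul_of_exp_eq_one hc h1, integral_mul_cexp_neg_mul_of_exp_eq_one hc h1,
    intervalIntegral.integral_finsetSum fun m _ => hlog m, hsum]
  · ring
  · exact Continuous.intervalIntegrable (by fun_prop) _ _
  · exact Continuous.intervalIntegrable (by fun_prop) _ _
  · exact Continuous.intervalIntegrable (by fun_prop) _ _
  · simpa only [Finset.sum_fn] using IntervalIntegrable.sum _ fun m _ => hlog m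

end FourierCoefficients

lemma intervalIntegrable_logGammaSeq (n : ℕ) :
    IntervalIntegrable (fun x => (BohrMollerup.logGammaSeq x n : ℂ)) volume 0 1 := by
  have : (fun x => (BohrMollerup.logGammaSeq x n : ℂ)) = fun x : ℝ =>
      ((x : ℂ) * Real.log n + Real.log n.factorial)
        - ∑ m ∈ Finset.range (n + 1), (Real.log (x + m) : ℂ) := by
    ext x
    simp [BohrMollerup.logGammaSeq]
  rw [this]
  refine (Continuous.intervalIntegrable (by fun_prop) _ _).sub ?_
  simpa only [Finset.sum_fn] using
    IntervalIntegrable.sum _ fun m _ => intervalIntegrable_log_add_nat m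

lemma tendsto_integral_logGammaSeq_mul {g : ℝ → ℂ} (hg : Continuous g) (hg1 : ∀ x, ‖g x‖ ≤ 1) :
    Tendsto (fun n : ℕ => ∫ x in (0:ℝ)..1, (BohrMollerup.logGammaSeq x n : ℂ) * g x) atTop
      (𝓝 (∫ x in (0:ℝ)..1, (Real.log (Real.Gamma x) : ℂ) * g x)) := by
  rw [tendsto_iff_norm_sub_tendsto_zero]
  refine squeeze_zero' (.of_forall fun _ => norm_nonneg _) ?_
    Real.tendsto_log_nat_add_one_sub_log
  filter_upwards [eventually_ne_atTop 0] with n hn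
  have hG : IntervalIntegrable (fun x => (Real.log (Real.Gamma x) : ℂ)) volume 0 1 :=
    intervalIntegrable_log_Gamma.complex_ofReal
  rw [← intervalIntegral.integral_sub
    ((intervalIntegrable_logGammaSeq n).mul_continuousOn hg.continuousOn)
    (hG.mul_continuousOn hg.continuousOn)]
  have := intervalIntegral.norm_integral_le_of_norm_le_const (a := (0:ℝ)) (b := 1)
    (f := fun x => (BohrMollerup.logGammaSeq x n : ℂ) * g x - (Real.log (Real.Gamma x) : ℂ) * g x)
    (C := Real.log (n + 1) - Real.log n) fun x hx => ?_
  · simpa using this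
  · rw [uIoc_of_le zero_le_one] at hx
    have h := abs_logGammaSeq_sub_log_Gamma_le hx.1 hx.2 hn
    rw [← sub_mul, norm_mul, ← ofReal_sub, norm_real, Real.norm_eq_abs]
    nlinarith [hg1 x, norm_nonneg (g x), abs_nonneg
      (BohrMollerup.logGammaSeq x n - Real.log (Real.Gamma x))]

lemma integral_log_Gamma_mul_cexp {c : ℂ} (hc : c ≠ 0) (h1 : Complex.exp (-c) = 1)
    (hre : c.re = 0) :
    ∫ x in (0:ℝ)..1, (Real.log (Real.Gamma x) : ℂ) * Complex.exp (-(c * x)) =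
      c⁻¹ * (Complex.log c + Real.eulerMascheroniConstant) := by
  have hlim := tendsto_integral_logGammaSeq_mul (g := fun x : ℝ => Complex.exp (-(c * x)))
    (by fun_prop) fun x => by simp [Complex.norm_exp, hre]
  refine tendsto_nhds_unique hlim ?_
  simp_rw [integral_logGammaSeq_mul_cexp hc h1]
  refine Tendsto.const_mul _ ?_
  have hE := (tendsto_complexEin_mul_sub_log hc hre.ge).comp
    ((tendsto_natCast_atTop_atTop (R := ℝ)).comp (tendsto_add_atTop_nat 1))
  have hL := (continuous_ofReal.tendsto 0).comp Real.tendsto_log_nat_add_one_sub_log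
  have h := hE.add hL
  rw [ofReal_zero, add_zero] at h
  refine h.congr fun n => ?_
  simp

theorem kummer_fourier_coeffs (n : ℤ) (hn : n ≠ 0) :
    (∫ α in (0:ℝ)..1,
        (Real.log (Real.Gamma α / Real.sqrt (2 * π)) : ℂ) * Complex.exp (-2 * π * I * n * α)
      = (2 * π * I * n)⁻¹ *
          (Complex.log (2 * π * I * n) + (Real.eulerMascheroniConstant : ℂ)))
    ∧ ∫ α in (0:ℝ)..1, Real.log (Real.Gamma α / Real.sqrt (2 * π)) = 0 := by
  have hsqrt : √(2 * π) ≠ 0 := by positivity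
  have hlog : ∀ α ∈ Ioo (0:ℝ) 1, Real.log (Real.Gamma α / √(2 * π)) =
      Real.log (Real.Gamma α) - Real.log √(2 * π) := fun α hα =>
    Real.log_div (Real.Gamma_pos_of_pos hα.1).ne' hsqrt
  constructor
  · set c : ℂ := 2 * π * I * n with hc_def
    have hc : c ≠ 0 := by simp [hc_def, hn]
    have h1 : Complex.exp (-c) = 1 := by
      rw [Complex.exp_eq_one_iff]
      exact ⟨-n, by rw [hc_def]; push_cast; ring⟩
    have hre : c.re = 0 := by simp [hc_def]
    have hexp : Continuous fun x : ℝ => Complex.exp (-(c * x)) := by fun_prop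
    have hG : IntervalIntegrable (fun x => (Real.log (Real.Gamma x) : ℂ)) volume 0 1 :=
      intervalIntegrable_log_Gamma.complex_ofReal
    rw [← integral_log_Gamma_mul_cexp hc h1 hre,
      ← sub_zero (∫ x in (0:ℝ)..1, (Real.log (Real.Gamma x) : ℂ) * Complex.exp (-(c * x))),
      ← mul_zero (Real.log √(2 * π) : ℂ), ← integral_cexp_neg_mul_of_exp_eq_one hc h1,
      ← intervalIntegral.integral_const_mul, ← intervalIntegral.integral_sub
        (hG.mul_continuousOn hexp.continuousOn)
        (Continuous.intervalIntegrable (by fun_prop) _ _)]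
    refine intervalIntegral.integral_congr_Ioo_of_le zero_le_one fun α hα => ?_
    have harg : -2 * π * I * n * α = -(c * α) := by rw [hc_def]; ring
    simp only [hlog α hα, harg]
    push_cast
    ring
  · rw [intervalIntegral.integral_congr_Ioo_of_le zero_le_one hlog,
      intervalIntegral.integral_sub intervalIntegrable_log_Gamma intervalIntegrable_const,
      integral_log_Gamma, Real.log_sqrt (by positivity)]
    simp
end

section
/- For a complex number s with Re(s) > 0, a real α with 0 < α ≤ 1, and an integer n ≥ 0, ∫₀¹ φ(λ,α,s) e^{-2πinλ} dλ = (n+α)^{-s}; for every negative integer n, ∫₀¹ φ(λ,α,s) e^{-2πinλ} dλ = 0. -/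
open Complex Real

open Filter Topology MeasureTheory Set

/-- Summation by parts, in the limit: if `a → 0` and `d` has bounded partial sums, the series
`∑ a k * d k` and its Abel transform have the same sum. -/
theorem hasSum_eq_of_summation_by_parts {a d : ℕ → ℂ} {A B : ℂ} {M : ℝ}
    (ha : Tendsto a atTop (𝓝 0)) (hd : ∀ N, ‖∑ k ∈ Finset.range N, d k‖ ≤ M)
    (hA : HasSum (fun k => a k * d k) A)
    (hB : HasSum (fun m => (a m - a (m + 1)) * ∑ k ∈ Finset.range (m + 1), d k) B) : B = A := by
  have hparts : ∀ N, ∑ m ∈ Finset.range N, (a m - a (m + 1)) * ∑ k ∈ Finset.range (m + 1), d k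
      = ∑ k ∈ Finset.range N, a k * d k - a N * ∑ k ∈ Finset.range N, d k := by
    intro N
    induction N with
    | zero => simp
    | succ N ih =>
      rw [Finset.sum_range_succ, ih, Finset.sum_range_succ (fun k => a k * d k),
        Finset.sum_range_succ d]
      ring
  have hboundary : Tendsto (fun N => a N * ∑ k ∈ Finset.range N, d k) atTop (𝓝 0) := by
    refine squeeze_zero_norm (a := fun N => ‖a N‖ * M) (fun N => ?_) ?_
    · rw [norm_mul]
      exact mul_le_mul_of_nonneg_left (hd N) (norm_nonneg _)
    · simpa using ha.norm.mul_const M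
  have hlim := hA.tendsto_sum_nat.sub hboundary
  rw [sub_zero] at hlim
  refine tendsto_nhds_unique hB.tendsto_sum_nat (hlim.congr fun N => (hparts N).symm)

theorem norm_cpow_neg_sub_le {x : ℝ} (hx : 0 < x) {s : ℂ} (hs : 0 < s.re) :
    ‖(x : ℂ) ^ (-s) - ((x + 1 : ℝ) : ℂ) ^ (-s)‖ ≤ ‖s‖ * x ^ (-s.re - 1) := by
  have hs0 : -s ≠ 0 := by
    intro h
    have : s = 0 := neg_eq_zero.mp h
    simp [this] at hs
  have hderiv : ∀ t ∈ Icc x (x + 1), HasDerivWithinAt (fun t : ℝ => (t : ℂ) ^ (-s))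
      (-s * (t : ℂ) ^ (-s - 1)) (Icc x (x + 1)) t := fun t ht =>
    (hasDerivAt_ofReal_cpow_const (lt_of_lt_of_le hx ht.1).ne' hs0).hasDerivWithinAt
  have hbound : ∀ t ∈ Ico x (x + 1), ‖-s * (t : ℂ) ^ (-s - 1)‖ ≤ ‖s‖ * x ^ (-s.re - 1) := by
    intro t ht
    have ht0 : 0 < t := lt_of_lt_of_le hx ht.1
    rw [norm_mul, norm_neg, norm_cpow_eq_rpow_re_of_pos ht0]
    simp only [sub_re, neg_re, one_re]
    exact mul_le_mul_of_nonneg_left (Real.rpow_le_rpow_of_nonpos hx ht.1 (by linarith))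
      (norm_nonneg _)
  have h := norm_image_sub_le_of_norm_deriv_le_segment' hderiv hbound (x + 1)
    ⟨by linarith, le_rfl⟩
  rw [norm_sub_rev]
  simpa using h

/-- The differences of consecutive coefficients are `O((m + 1)^{-δ-1})`, uniformly for `s` in a
bounded part of the half-plane `δ ≤ Re s`. -/
theorem norm_cpow_neg_sub_succ_le {α δ R : ℝ} (h0 : 0 < α) (h1 : α ≤ 1) (hδ : 0 < δ) {s : ℂ}
    (hs : δ ≤ s.re) (hR : ‖s‖ ≤ R) (m : ℕ) :
    ‖((m : ℂ) + α) ^ (-s) - (((m + 1 : ℕ) : ℂ) + α) ^ (-s)‖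
      ≤ R * α ^ (-R - 1) * ((m : ℝ) + 1) ^ (-δ - 1) := by
  have hm : (0 : ℝ) ≤ m := m.cast_nonneg
  have hx : 0 < (m : ℝ) + α := by linarith
  have h := norm_cpow_neg_sub_le hx (s := s) (by linarith)
  have e1 : (((m : ℝ) + α : ℝ) : ℂ) = (m : ℂ) + α := by push_cast; rfl
  have e2 : (((m : ℝ) + α + 1 : ℝ) : ℂ) = ((m + 1 : ℕ) : ℂ) + α := by push_cast; ring
  rw [e1, e2] at h
  have hσR : s.re ≤ R := ((le_abs_self _).trans (abs_re_le_norm s)).trans hR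
  refine h.trans ?_
  rw [mul_assoc]
  refine mul_le_mul hR ?_ (by positivity) ((norm_nonneg _).trans hR)
  calc ((m : ℝ) + α) ^ (-s.re - 1) ≤ (α * ((m : ℝ) + 1)) ^ (-s.re - 1) :=
        Real.rpow_le_rpow_of_nonpos (by positivity) (by nlinarith) (by linarith)
    _ = α ^ (-s.re - 1) * ((m : ℝ) + 1) ^ (-s.re - 1) :=
        Real.mul_rpow h0.le (by positivity)
    _ ≤ α ^ (-R - 1) * ((m : ℝ) + 1) ^ (-δ - 1) := by
        refine mul_le_mul ?_ ?_ (by positivity) (by positivity)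
        · exact Real.rpow_le_rpow_of_exponent_ge h0 h1 (by linarith)
        · exact Real.rpow_le_rpow_of_exponent_le (by linarith) (by linarith)

theorem summable_add_one_rpow {p : ℝ} (hp : p < -1) :
    Summable fun m : ℕ => ((m : ℝ) + 1) ^ p := by
  have h := (summable_nat_add_iff 1).mpr (Real.summable_nat_rpow.mpr hp)
  simpa using h

theorem tendsto_natCast_add_cpow_neg {α : ℝ} (h0 : 0 < α) {s : ℂ} (hs : 0 < s.re) :
    Tendsto (fun m : ℕ => ((m : ℂ) + α) ^ (-s)) atTop (𝓝 0) := by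
  rw [tendsto_zero_iff_norm_tendsto_zero]
  have h : Tendsto (fun m : ℕ => ((m : ℝ) + α) ^ (-s.re)) atTop (𝓝 0) :=
    (tendsto_rpow_neg_atTop hs).comp
      (tendsto_atTop_add_const_right _ α tendsto_natCast_atTop_atTop)
  refine h.congr fun m => ?_
  have hx : 0 < (m : ℝ) + α := by positivity
  have := norm_cpow_eq_rpow_re_of_pos hx (-s)
  push_cast at this
  rw [this, neg_re]

theorem norm_exp_two_pi_mul (lam : ℝ) (k : ℕ) :
    ‖Complex.exp (2 * π * I * lam * k)‖ = 1 := by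
  have : (2 * π * I * lam * k : ℂ) = ((2 * π * lam * k : ℝ) : ℂ) * I := by push_cast; ring
  rw [this, norm_exp_ofReal_mul_I]

theorem norm_sum_exp_le_natCast (lam : ℝ) (N : ℕ) :
    ‖∑ k ∈ Finset.range N, Complex.exp (2 * π * I * lam * k)‖ ≤ N := by
  refine (norm_sum_le _ _).trans ?_
  simp [norm_exp_two_pi_mul]

theorem norm_sum_exp_mul_sin_le (lam : ℝ) (N : ℕ) :
    ‖∑ k ∈ Finset.range N, Complex.exp (2 * π * I * lam * k)‖ * |Real.sin (π * lam)| ≤ 1 := by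
  have hpow : ∀ k : ℕ, Complex.exp (2 * π * I * lam * k)
      = Complex.exp (I * ((2 * π * lam : ℝ) : ℂ)) ^ k := by
    intro k
    rw [← Complex.exp_nat_mul]
    congr 1
    push_cast
    ring
  have hgeom := geom_sum_mul (Complex.exp (I * ((2 * π * lam : ℝ) : ℂ))) N
  have hnorm := congrArg norm hgeom
  rw [norm_mul, Complex.norm_exp_I_mul_ofReal_sub_one, ← hpow] at hnorm
  have hle : ‖Complex.exp (2 * π * I * lam * N) - 1‖ ≤ 2 := by
    refine (norm_sub_le _ _).trans ?_
    rw [norm_exp_two_pi_mul, norm_one]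
    norm_num
  have harg : 2 * π * lam / 2 = π * lam := by ring
  rw [harg, norm_mul, Real.norm_eq_abs, Real.norm_eq_abs, abs_two] at hnorm
  simp only [hpow] at hle hnorm ⊢
  linarith

theorem norm_sum_exp_le_inv_of_le_half {lam : ℝ} (h0 : 0 < lam) (h : lam ≤ 1 / 2) (N : ℕ) :
    ‖∑ k ∈ Finset.range N, Complex.exp (2 * π * I * lam * k)‖ ≤ lam⁻¹ := by
  have hsin : 2 / π * (π * lam) ≤ Real.sin (π * lam) :=
    Real.mul_le_sin (by positivity) (by nlinarith [Real.pi_pos])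
  have hsimp : 2 / π * (π * lam) = 2 * lam := by
    field_simp
  have habs := le_abs_self (Real.sin (π * lam))
  have hD := norm_sum_exp_mul_sin_le lam N
  rw [← one_div, le_div_iff₀ h0]
  refine le_trans ?_ hD
  exact mul_le_mul_of_nonneg_left (by linarith) (norm_nonneg _)

theorem norm_sum_exp_le_inv_of_half_le {lam : ℝ} (h1 : lam < 1) (h : 1 / 2 ≤ lam) (N : ℕ) :
    ‖∑ k ∈ Finset.range N, Complex.exp (2 * π * I * lam * k)‖ ≤ (1 - lam)⁻¹ := by
  have hsin : 2 / π * (π * (1 - lam)) ≤ Real.sin (π * (1 - lam)) :=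
    Real.mul_le_sin (mul_nonneg Real.pi_pos.le (by linarith)) (by nlinarith [Real.pi_pos])
  have hsimp : 2 / π * (π * (1 - lam)) = 2 * (1 - lam) := by
    field_simp
  have hrefl : Real.sin (π * (1 - lam)) = Real.sin (π * lam) := by
    rw [mul_sub, mul_one, Real.sin_pi_sub]
  have habs := le_abs_self (Real.sin (π * lam))
  have hD := norm_sum_exp_mul_sin_le lam N
  rw [← one_div, le_div_iff₀ (by linarith)]
  refine le_trans ?_ hD
  exact mul_le_mul_of_nonneg_left (by linarith) (norm_nonneg _)

theorem le_rpow_mul_rpow_of_le_of_le_inv {x y t ε : ℝ} (hx : 0 ≤ x) (hxy : x ≤ y) (ht : 0 < t)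
    (hxt : x ≤ t⁻¹) (hε : 0 < ε) (hε1 : ε < 1) : x ≤ y ^ ε * t ^ (ε - 1) := by
  have hsplit : x = x ^ ε * x ^ (1 - ε) := by
    rw [← Real.rpow_add_of_nonneg hx hε.le (by linarith)]
    simp
  have ht' : t ^ (ε - 1) = (t⁻¹) ^ (1 - ε) := by
    rw [Real.inv_rpow ht.le, ← Real.rpow_neg ht.le]
    congr 1
    ring
  rw [ht']
  calc x = x ^ ε * x ^ (1 - ε) := hsplit
    _ ≤ y ^ ε * (t⁻¹) ^ (1 - ε) :=
      mul_le_mul (Real.rpow_le_rpow hx hxy hε.le) (Real.rpow_le_rpow hx hxt (by linarith))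
        (by positivity) (Real.rpow_nonneg (hx.trans hxy) _)

/-- The Dirichlet kernel interpolated between its trivial bound and its bound away from `0`
and `1`. -/
theorem norm_sum_exp_le_rpow {lam ε : ℝ} (h0 : 0 < lam) (h1 : lam < 1) (hε : 0 < ε)
    (hε1 : ε < 1) (N : ℕ) :
    ‖∑ k ∈ Finset.range N, Complex.exp (2 * π * I * lam * k)‖
      ≤ (N : ℝ) ^ ε * (lam ^ (ε - 1) + (1 - lam) ^ (ε - 1)) := by
  have h1' : 0 < 1 - lam := by linarith
  have hN := norm_sum_exp_le_natCast lam N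
  rcases le_total lam (1 / 2) with h | h
  · refine (le_rpow_mul_rpow_of_le_of_le_inv (norm_nonneg _) hN h0
      (norm_sum_exp_le_inv_of_le_half h0 h N) hε hε1).trans ?_
    have : 0 ≤ (1 - lam) ^ (ε - 1) := by positivity
    exact mul_le_mul_of_nonneg_left (by linarith) (by positivity)
  · refine (le_rpow_mul_rpow_of_le_of_le_inv (norm_nonneg _) hN h1'
      (norm_sum_exp_le_inv_of_half_le h1 h N) hε hε1).trans ?_
    have : 0 ≤ lam ^ (ε - 1) := by positivity
    exact mul_le_mul_of_nonneg_left (by linarith) (by positivity)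

theorem exists_norm_sum_exp_le {lam : ℝ} (h0 : 0 < lam) (h1 : lam < 1) :
    ∃ M, ∀ N, ‖∑ k ∈ Finset.range N, Complex.exp (2 * π * I * lam * k)‖ ≤ M := by
  rcases le_total lam (1 / 2) with h | h
  · exact ⟨_, norm_sum_exp_le_inv_of_le_half h0 h⟩
  · exact ⟨_, norm_sum_exp_le_inv_of_half_le h1 h⟩

theorem intervalIntegrable_rpow_add_rpow_one_sub {ε : ℝ} (hε : 0 < ε) :
    IntervalIntegrable (fun x : ℝ => x ^ (ε - 1) + (1 - x) ^ (ε - 1)) volume 0 1 := by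
  have h : ∀ a b : ℝ, IntervalIntegrable (fun x : ℝ => x ^ (ε - 1)) volume a b := fun a b =>
    intervalIntegral.intervalIntegrable_rpow' (by linarith)
  refine (h 0 1).add ?_
  have h' := (h 1 0).comp_sub_left 1
  simpa using h'

theorem hasSum_lerch_series {α : ℝ} (h0 : 0 < α) {s : ℂ} (hs : 1 < s.re) {lam : ℝ} :
    HasSum (fun m : ℕ => ((m : ℂ) + α) ^ (-s) * Complex.exp (2 * π * I * lam * m))
      (∑' m : ℕ, Complex.exp (2 * π * I * lam * m) * ((m : ℂ) + α) ^ (-s)) := by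
  have hsum : Summable fun m : ℕ =>
      Complex.exp (2 * π * I * lam * m) * ((m : ℂ) + α) ^ (-s) := by
    have hreal : Summable fun m : ℕ => ‖1 / |(m : ℝ) + α| ^ s.re‖ := by
      exact ((Real.summable_one_div_nat_add_rpow α s.re).mpr hs).norm
    refine Summable.of_norm_bounded hreal fun m => ?_
    have hx : 0 < (m : ℝ) + α := by positivity
    have h := norm_cpow_eq_rpow_re_of_pos hx (-s)
    push_cast at h
    rw [norm_mul, norm_exp_two_pi_mul, one_mul, h, neg_re, abs_of_pos hx, Real.rpow_neg hx.le,
      one_div, Real.norm_of_nonneg (by positivity)]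
  simpa only [mul_comm] using hsum.hasSum

/-- For `0 < λ < 1` the Abel transform of the Lerch series converges to the analytic continuation
in the half-plane `0 < Re s`. -/
theorem hasSum_lerch_abel (f : ℂ → ℂ) (hf : Differentiable ℂ f) {α lam : ℝ}
    (h0 : 0 < α) (h1 : α ≤ 1) (hl0 : 0 < lam) (hl1 : lam < 1)
    (hser : ∀ s : ℂ, 1 < s.re →
      f s = ∑' m : ℕ, Complex.exp (2 * π * I * lam * m) * ((m : ℂ) + α) ^ (-s))
    {s : ℂ} (hs : 0 < s.re) :
    HasSum (fun m : ℕ => (((m : ℂ) + α) ^ (-s) - (((m + 1 : ℕ) : ℂ) + α) ^ (-s)) *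
      ∑ k ∈ Finset.range (m + 1), Complex.exp (2 * π * I * lam * k)) (f s) := by
  obtain ⟨M, hM⟩ := exists_norm_sum_exp_le hl0 hl1
  set δ := s.re / 2 with hδ
  have hδ0 : 0 < δ := by positivity
  set R := ‖s‖ + 3 with hRdef
  set U : Set ℂ := {w : ℂ | δ < w.re} ∩ Metric.ball 0 R with hU
  have hUo : IsOpen U := (isOpen_lt continuous_const continuous_re).inter Metric.isOpen_ball
  have hUc : IsPreconnected U :=
    ((convex_halfSpace_re_gt δ).inter (convex_ball 0 R)).isPreconnected
  have hsU : s ∈ U := ⟨by simp only [mem_ofPred_eq]; linarith, by simp [hRdef]⟩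
  have hre : s.re ≤ ‖s‖ := (le_abs_self _).trans (abs_re_le_norm s)
  have hpU : ((‖s‖ + 2 : ℝ) : ℂ) ∈ U := by
    refine ⟨?_, ?_⟩
    · simp only [mem_ofPred_eq, ofReal_re]; linarith
    · rw [mem_ball_zero_iff, norm_real, Real.norm_of_nonneg (by positivity)]
      linarith
  set F : ℕ → ℂ → ℂ := fun m w => (((m : ℂ) + α) ^ (-w) - (((m + 1 : ℕ) : ℂ) + α) ^ (-w)) *
      ∑ k ∈ Finset.range (m + 1), Complex.exp (2 * π * I * lam * k) with hF
  have hbase : ∀ m : ℕ, (m : ℂ) + α ≠ 0 := by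
    intro m
    have hx : (m : ℝ) + α ≠ 0 := by positivity
    exact_mod_cast hx
  have hFd : ∀ m, DifferentiableOn ℂ (F m) U := by
    intro m
    have hd : ∀ m : ℕ, Differentiable ℂ fun w : ℂ => ((m : ℂ) + α) ^ (-w) := fun m =>
      differentiable_neg.const_cpow (Or.inl (hbase m))
    exact (((hd m).sub (hd (m + 1))).mul_const _).differentiableOn
  have hu : Summable fun m : ℕ => R * α ^ (-R - 1) * ((m : ℝ) + 1) ^ (-δ - 1) * M :=
    ((summable_add_one_rpow (by linarith)).mul_left _).mul_right _
  have hFle : ∀ m w, w ∈ U → ‖F m w‖ ≤ R * α ^ (-R - 1) * ((m : ℝ) + 1) ^ (-δ - 1) * M := by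
    intro m w hw
    rw [hF, norm_mul]
    have hwR : ‖w‖ ≤ R := (mem_ball_zero_iff.mp hw.2).le
    refine mul_le_mul (norm_cpow_neg_sub_succ_le h0 h1 hδ0 (le_of_lt hw.1) hwR m) (hM _)
      (norm_nonneg _) (by positivity)
  have hsummable : ∀ w ∈ U, Summable fun m => F m w := fun w hw =>
    Summable.of_norm_bounded hu fun m => hFle m w hw
  have hGd : DifferentiableOn ℂ (fun w => ∑' m, F m w) U :=
    Complex.differentiableOn_tsum_of_summable_norm hu hFd hUo hFle
  have heq : EqOn (fun w => ∑' m, F m w) f U := by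
    refine (hGd.analyticOnNhd hUo).eqOn_of_preconnected_of_eventuallyEq
      (hf.differentiableOn.analyticOnNhd hUo) hUc hpU ?_
    have hnear : ∀ᶠ w : ℂ in 𝓝 ((‖s‖ + 2 : ℝ) : ℂ), 1 < w.re := by
      refine (isOpen_lt continuous_const continuous_re).mem_nhds ?_
      simp only [mem_ofPred_eq, ofReal_re]
      linarith [norm_nonneg s]
    filter_upwards [hnear, hUo.mem_nhds hpU] with w hw hwU
    rw [hser w hw]
    exact hasSum_eq_of_summation_by_parts (tendsto_natCast_add_cpow_neg h0 (by linarith)) hM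
      (hasSum_lerch_series h0 hw) (hsummable w hwU).hasSum
  have h := (hsummable s hsU).hasSum
  rwa [show ∑' m, F m s = f s from heq hsU] at h

theorem integral_exp_mul_exp_neg (k : ℕ) (n : ℤ) :
    ∫ lam in (0:ℝ)..1, Complex.exp (2 * π * I * lam * k) * Complex.exp (-2 * π * I * n * lam)
      = if (k : ℤ) = n then 1 else 0 := by
  have hexp : ∀ lam : ℝ, Complex.exp (2 * π * I * lam * k) * Complex.exp (-2 * π * I * n * lam)
      = Complex.exp (((((k : ℤ) - n : ℤ) : ℂ) * (2 * π * I)) * lam) := by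
    intro lam
    rw [← Complex.exp_add]
    congr 1
    push_cast
    ring
  simp only [hexp]
  split_ifs with h
  · simp [h]
  · have hc : (((k : ℤ) - n : ℤ) : ℂ) * (2 * π * I) ≠ 0 :=
      mul_ne_zero (by exact_mod_cast sub_ne_zero.mpr h) two_pi_I_ne_zero
    rw [integral_exp_mul_complex hc]
    have h1 := Complex.exp_int_mul_two_pi_mul_I ((k : ℤ) - n)
    rw [ofReal_one, ofReal_zero, mul_one, mul_zero, h1, Complex.exp_zero, sub_self, zero_div]

theorem norm_sum_ite_eq_le_one (n : ℤ) (N : ℕ) :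
    ‖∑ k ∈ Finset.range N, (if (k : ℤ) = n then (1 : ℂ) else 0)‖ ≤ 1 := by
  rcases lt_or_ge n 0 with hn | hn
  · have : ∀ k : ℕ, (k : ℤ) ≠ n := fun k => by omega
    simp [this]
  · lift n to ℕ using hn
    simp only [Nat.cast_inj, Finset.sum_ite_eq']
    split_ifs <;> simp

/-- Integrating the Abel transform of the Lerch series termwise against a character. -/
theorem hasSum_integral_lerch_abel (g : ℝ → ℂ) {α : ℝ} (h0 : 0 < α) (h1 : α ≤ 1) {s : ℂ}
    (hs : 0 < s.re)
    (hg : ∀ lam : ℝ, 0 < lam → lam < 1 →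
      HasSum (fun m : ℕ => (((m : ℂ) + α) ^ (-s) - (((m + 1 : ℕ) : ℂ) + α) ^ (-s)) *
        ∑ k ∈ Finset.range (m + 1), Complex.exp (2 * π * I * lam * k)) (g lam)) (n : ℤ) :
    HasSum (fun m : ℕ => (((m : ℂ) + α) ^ (-s) - (((m + 1 : ℕ) : ℂ) + α) ^ (-s)) *
        ∑ k ∈ Finset.range (m + 1), (if (k : ℤ) = n then (1 : ℂ) else 0))
      (∫ lam in (0:ℝ)..1, g lam * Complex.exp (-2 * π * I * n * lam)) := by
  set ε := min (s.re / 2) (1 / 2) with hε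
  have hε0 : 0 < ε := lt_min (by linarith) (by norm_num)
  have hε1 : ε < 1 := (min_le_right _ _).trans_lt (by norm_num)
  have hεs : ε < s.re := (min_le_left _ _).trans_lt (by linarith)
  set c : ℕ → ℂ := fun m => ((m : ℂ) + α) ^ (-s) - (((m + 1 : ℕ) : ℂ) + α) ^ (-s) with hc
  set F : ℕ → ℝ → ℂ := fun m lam => c m *
    (∑ k ∈ Finset.range (m + 1), Complex.exp (2 * π * I * lam * k)) *
      Complex.exp (-2 * π * I * n * lam) with hF
  set w : ℝ → ℝ := fun x => x ^ (ε - 1) + (1 - x) ^ (ε - 1) with hw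
  have hFc : ∀ m, Continuous (F m) := fun m => by
    rw [hF]
    fun_prop
  have hFi : ∀ m, Integrable (F m) (volume.restrict (Ioo (0:ℝ) 1)) := fun m =>
    ((hFc m).integrableOn_Icc (a := 0) (b := 1)).mono_set Ioo_subset_Icc_self
  have hwi : IntegrableOn w (Ioo (0:ℝ) 1) :=
    ((intervalIntegrable_iff_integrableOn_Ioo_of_le zero_le_one).mp
      (intervalIntegrable_rpow_add_rpow_one_sub hε0))
  have hchar : ∀ lam : ℝ, ‖Complex.exp (-2 * π * I * n * lam)‖ = 1 := fun lam => by
    have : (-2 * π * I * n * lam : ℂ) = ((-2 * π * n * lam : ℝ) : ℂ) * I := by push_cast; ring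
    rw [this, norm_exp_ofReal_mul_I]
  set C := ‖s‖ * α ^ (-‖s‖ - 1)
  have hFle : ∀ m, ∫ lam in Ioo (0:ℝ) 1, ‖F m lam‖
      ≤ C * ((m : ℝ) + 1) ^ (ε - s.re - 1) * ∫ lam in Ioo (0:ℝ) 1, w lam := by
    intro m
    rw [← integral_const_mul]
    refine setIntegral_mono_on (hFi m).norm (hwi.const_mul _) measurableSet_Ioo ?_
    intro lam hlam
    have hcm := norm_cpow_neg_sub_succ_le h0 h1 hs le_rfl le_rfl m
    have hD := norm_sum_exp_le_rpow hlam.1 hlam.2 hε0 hε1 (m + 1)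
    have hm : (0:ℝ) < (m : ℝ) + 1 := by positivity
    have hpow : ((m : ℝ) + 1) ^ (ε - s.re - 1)
        = ((m : ℝ) + 1) ^ (-s.re - 1) * ((m : ℝ) + 1) ^ ε := by
      rw [← Real.rpow_add hm]
      congr 1
      ring
    rw [hF, norm_mul, norm_mul, hchar, mul_one, hpow]
    push_cast at hD
    refine (mul_le_mul hcm hD (norm_nonneg _) (by positivity)).trans (le_of_eq ?_)
    ring
  have hFs : Summable fun m => ∫ lam in Ioo (0:ℝ) 1, ‖F m lam‖ := by
    refine Summable.of_nonneg_of_le (fun m => integral_nonneg fun _ => norm_nonneg _) hFle ?_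
    exact ((summable_add_one_rpow (by linarith)).mul_left C).mul_right _
  have key := hasSum_integral_of_summable_integral_norm hFi hFs
  have hlim : ∫ lam in Ioo (0:ℝ) 1, ∑' m, F m lam
      = ∫ lam in (0:ℝ)..1, g lam * Complex.exp (-2 * π * I * n * lam) := by
    rw [intervalIntegral.integral_of_le zero_le_one, integral_Ioc_eq_integral_Ioo]
    refine setIntegral_congr_fun measurableSet_Ioo fun lam hlam => ?_
    exact ((hg lam hlam.1 hlam.2).mul_right _).tsum_eq
  rw [hlim] at key
  refine key.congr_fun fun m => ?_
  rw [← integral_Ioc_eq_integral_Ioo, ← intervalIntegral.integral_of_le zero_le_one]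
  simp only [hF, mul_assoc, Finset.sum_mul]
  rw [intervalIntegral.integral_const_mul, intervalIntegral.integral_finsetSum]
  · congr 1
    refine Finset.sum_congr rfl fun k _ => ?_
    rw [← integral_exp_mul_exp_neg k n]
    simp only [mul_assoc]
  · intro k _
    refine Continuous.intervalIntegrable ?_ _ _
    fun_prop

/-- Fourier coefficients in `λ` of the Lerch zeta function `φ(λ, α, s)`, characterized as the
unique function agreeing with the Dirichlet series `∑ e^{2πiλm}(m+α)^{-s}` for `1 < Re s`
and entire in `s` for `0 < λ < 1`. -/
theorem lerch_fourier_coeffs_in_lambda (φ : ℝ → ℝ → ℂ → ℂ)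
    (hser : ∀ (lam α : ℝ) (s : ℂ), 0 < α → 1 < s.re →
      φ lam α s = ∑' m : ℕ, Complex.exp (2 * π * I * lam * m) * ((m : ℂ) + α) ^ (-s))
    (hanal : ∀ (lam α : ℝ), 0 < lam → lam < 1 → 0 < α → Differentiable ℂ (φ lam α))
    (s : ℂ) (hs : 0 < s.re) (α : ℝ) (h0 : 0 < α) (h1 : α ≤ 1) :
    (∀ n : ℕ, ∫ lam in (0:ℝ)..1, φ lam α s * Complex.exp (-2 * π * I * n * lam)
        = ((n : ℂ) + α) ^ (-s))
    ∧ ∀ n : ℤ, n < 0 → ∫ lam in (0:ℝ)..1, φ lam α s * Complex.exp (-2 * π * I * n * lam)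
        = 0 := by
  have main : ∀ n : ℤ, HasSum
      (fun m : ℕ => (((m : ℂ) + α) ^ (-s) - (((m + 1 : ℕ) : ℂ) + α) ^ (-s)) *
        ∑ k ∈ Finset.range (m + 1), (if (k : ℤ) = n then (1 : ℂ) else 0))
      (∫ lam in (0:ℝ)..1, φ lam α s * Complex.exp (-2 * π * I * n * lam)) :=
    hasSum_integral_lerch_abel _ h0 h1 hs fun lam hl0 hl1 =>
      hasSum_lerch_abel (φ lam α) (hanal lam α hl0 hl1 h0) h0 h1 hl0 hl1
        (fun w hw => hser lam α w h0 hw) hs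
  have ha := tendsto_natCast_add_cpow_neg h0 hs
  refine ⟨fun n => ?_, fun n hn => ?_⟩
  · have h := main n
    simp only [Int.cast_natCast] at h
    refine hasSum_eq_of_summation_by_parts ha (norm_sum_ite_eq_le_one n) ?_ h
    convert hasSum_ite_eq n (((n : ℂ) + α) ^ (-s)) using 2 with k
    by_cases hk : k = n <;> simp [hk]
  · refine hasSum_eq_of_summation_by_parts ha (norm_sum_ite_eq_le_one n) ?_ (main n)
    have hne : ∀ k : ℕ, (k : ℤ) ≠ n := fun k => by omega
    simp [hne, hasSum_zero]
end
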